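/- (Kerov) For every permutation π ∈ S_k there exists a polynomial K_π with integer coefficients in countably many variables R_2, R_3, … (not depending on λ) such that for every Young diagram λ, Σ_π^λ = K_π(R_2^λ, R_3^λ, …). -/

import Mathlib

open scoped BigOperators

namespace AsympRep

/-- A fixed filling: the canonical bijection between `Fin μ.card` and the cells of `μ`. -/
noncomputable def fill (μ : YoungDiagram) : Fin μ.card ≃ {c // c ∈ μ.cells} :=
  (Fintype.equivFinOfCardEq (Fintype.card_coe _)).symm

/-- Row coordinate of the box occupied by `x` in the canonical filling. -/
noncomputable def rowOf (μ : YoungDiagram) (x : Fin μ.card) : ℕ := (fill μ x).1.1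

/-- Column coordinate of the box occupied by `x` in the canonical filling. -/
noncomputable def colOf (μ : YoungDiagram) (x : Fin μ.card) : ℕ := (fill μ x).1.2

/-- The Young symmetrizer `c_μ = a_μ * b_μ` in the group algebra `ℚ[S_n]`, `n = |μ|`,
where `a_μ` is the sum of the row-preserving permutations and `b_μ` is the signed sum
of the column-preserving permutations (for the canonical filling of `μ`). -/
noncomputable def youngSymmetrizer (μ : YoungDiagram) :
    MonoidAlgebra ℚ (Equiv.Perm (Fin μ.card)) :=
  (∑ g : Equiv.Perm (Fin μ.card),
      if ∀ x, rowOf μ (g x) = rowOf μ x then MonoidAlgebra.single g (1 : ℚ) else 0) *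
  (∑ g : Equiv.Perm (Fin μ.card),
      if ∀ x, colOf μ (g x) = colOf μ x
      then MonoidAlgebra.single g ((Equiv.Perm.sign g : ℤ) : ℚ) else 0)

/-- The Specht module: the left ideal `ℚ[S_n]·c_μ`, realizing the irreducible
representation `ρ^μ` of `S_n` (by left multiplication). -/
noncomputable def spechtModule (μ : YoungDiagram) :
    Submodule ℚ (MonoidAlgebra ℚ (Equiv.Perm (Fin μ.card))) :=
  LinearMap.range (LinearMap.mulRight ℚ (youngSymmetrizer μ))

theorem spechtModule_invariant (μ : YoungDiagram) (π : Equiv.Perm (Fin μ.card)) :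
    ∀ x ∈ spechtModule μ,
      (LinearMap.mulLeft ℚ (MonoidAlgebra.single π (1 : ℚ))) x ∈ spechtModule μ := by
  rintro x ⟨y, rfl⟩
  exact ⟨MonoidAlgebra.single π (1 : ℚ) * y, by
    simp only [LinearMap.mulRight_apply, LinearMap.mulLeft_apply, mul_assoc]⟩

/-- The irreducible character `χ^μ(π) = Tr ρ^μ(π)` of the symmetric group `S_n`,
`n = |μ|`, computed as the trace of left multiplication by `π` on the Specht module. -/
noncomputable def irrChar (μ : YoungDiagram) (π : Equiv.Perm (Fin μ.card)) : ℚ :=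
  LinearMap.trace ℚ (spechtModule μ)
    ((LinearMap.mulLeft ℚ (MonoidAlgebra.single π (1 : ℚ))).restrict
      (spechtModule_invariant μ π))

/-- The normalized character
`Σ_π^μ = n(n-1)⋯(n-k+1) · Tr ρ^μ(π) / Tr ρ^μ(e)` for `π ∈ S_k`, where `π` is regarded
as a permutation of `{1,…,n}` acting as the identity on `{k+1,…,n}`; it is `0` if `k > n`. -/
noncomputable def normChar {k : ℕ} (μ : YoungDiagram) (π : Equiv.Perm (Fin k)) : ℚ :=
  if h : k ≤ μ.card then
    (μ.card.descFactorial k : ℚ)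
      * irrChar μ (π.viaEmbedding (Fin.castLEEmb h)) / irrChar μ 1
  else 0

/-- `Σ_m^μ`: the normalized character on the `m`-cycle `(1,2,…,m) ∈ S_m`. -/
noncomputable def SigmaCycle (μ : YoungDiagram) (m : ℕ) : ℚ := normChar μ (finRotate m)

/-- The dilation `sμ` of a Young diagram: every box is replaced by an `s × s` grid
of boxes. -/
def dilate (μ : YoungDiagram) (s : ℕ) : YoungDiagram where
  cells := (Finset.range (s * μ.colLen 0) ×ˢ Finset.range (s * μ.rowLen 0)).filter
      (fun c => (c.1 / s, c.2 / s) ∈ μ.cells)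
  isLowerSet := by
    intro a b hba h
    simp only [Finset.coe_filter, Set.mem_setOf_eq, Finset.mem_product,
      Finset.mem_range] at h ⊢
    exact ⟨⟨lt_of_le_of_lt hba.1 h.1.1, lt_of_le_of_lt hba.2 h.1.2⟩,
      μ.isLowerSet (Prod.mk_le_mk.mpr
        ⟨Nat.div_le_div_right hba.1, Nat.div_le_div_right hba.2⟩) h.2⟩

open scoped Classical in
/-- The `k`-th free cumulant `R_k^μ`: the coefficient of `s^k` in the polynomial
`s ↦ Σ_{k-1}^{sμ}`. -/
noncomputable def freeCumulant (μ : YoungDiagram) (k : ℕ) : ℚ :=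
  if h : ∃ p : Polynomial ℚ, ∀ s : ℕ, 0 < s →
      SigmaCycle (dilate μ s) (k - 1) = Polynomial.eval (s : ℚ) p
  then h.choose.coeff k else 0

/-- `N^μ(σ₁,σ₂)`: the number of colorings of the cycles of `σ₁` (by column numbers)
and of the cycles of `σ₂` (by row numbers) compatible with `μ`.  A coloring of the
cycles is encoded as a pair of functions on points constant on the respective cycles;
compatibility means that for every point `a` the box in column `h₁(a)` and row `h₂(a)`
belongs to `μ` (two cycles intersect precisely when they share a point). -/
noncomputable def Ncolorings {k : ℕ} (μ : YoungDiagram) (σ₁ σ₂ : Equiv.Perm (Fin k)) : ℕ :=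
  Set.ncard {h : (Fin k → ℕ) × (Fin k → ℕ) |
    (∀ a, h.1 (σ₁ a) = h.1 a) ∧ (∀ a, h.2 (σ₂ a) = h.2 a) ∧
    ∀ a, (h.2 a, h.1 a) ∈ μ.cells }

/-- `|C(σ)|`: the number of cycles of a permutation (fixed points count as cycles),
i.e. the number of orbits. -/
noncomputable def numCycles {k : ℕ} (σ : Equiv.Perm (Fin k)) : ℕ :=
  Set.ncard {s : Set (Fin k) | ∃ a, s = {b | σ.SameCycle a b}}

/-- The region of the plane occupied by the Young diagram `μ` drawn in the French
convention (row `i` of the diagram, `0`-indexed, occupies `[0, μ_i] × [i, i+1]`). -/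
def frenchRegion (μ : YoungDiagram) : Set (ℝ × ℝ) :=
  {p | 0 ≤ p.1 ∧ 0 ≤ p.2 ∧ p.1 ≤ (μ.rowLen ⌊p.2⌋.toNat : ℝ)}

/-- The parameter `S_i^μ = (i-1) ∬_{(x,y)∈μ} (x-y)^{i-2} dx dy` (French convention). -/
noncomputable def Sparam (μ : YoungDiagram) (i : ℕ) : ℝ :=
  ((i : ℝ) - 1) * ∫ p in frenchRegion μ, (p.1 - p.2) ^ (i - 2)

/-- The profile `ω : ℝ → ℝ` of a Young diagram: the boundary of the diagram drawn in
the Russian convention, i.e. the image of the French region under the rotation by `π/4`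
composed with the dilation by `√2`, `(x, y) ↦ (x - y, x + y)`.  `ω(u)` is the largest
`v` with `(u,v)` in the rotated region, and `ω(u) = |u|` away from the diagram. -/
noncomputable def profile (μ : YoungDiagram) (u : ℝ) : ℝ :=
  max |u| (sSup {v : ℝ | ((u + v) / 2, (v - u) / 2) ∈ frenchRegion μ})

section Symmetrizer

open Equiv MonoidAlgebra

/-- The functions `row` and `col` label the elements of `X` bijectively by the cells of `μ`. -/
structure IsFilling (μ : YoungDiagram) {X : Type*} (row col : X → ℕ) : Prop where
  inj : ∀ x y, row x = row y → col x = col y → x = y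
  mem : ∀ x, (row x, col x) ∈ μ
  surj : ∀ c ∈ μ, ∃ x, row x = c.1 ∧ col x = c.2

variable {X : Type*} [Fintype X] [DecidableEq X]

/-- The sum of the permutations preserving `row`. -/
noncomputable def rowSum (row : X → ℕ) : MonoidAlgebra ℚ (Perm X) :=
  ∑ g : Perm X, if ∀ x, row (g x) = row x then single g (1 : ℚ) else 0

/-- The signed sum of the permutations preserving `col`. -/
noncomputable def colSum (col : X → ℕ) : MonoidAlgebra ℚ (Perm X) :=
  ∑ g : Perm X, if ∀ x, col (g x) = col x then single g ((Perm.sign g : ℤ) : ℚ) else 0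

/-- The Young symmetrizer of a filling. -/
noncomputable def symmetrizer (row col : X → ℕ) : MonoidAlgebra ℚ (Perm X) :=
  rowSum row * colSum col

theorem youngSymmetrizer_eq (μ : YoungDiagram) :
    youngSymmetrizer μ = symmetrizer (rowOf μ) (colOf μ) := by
  unfold youngSymmetrizer symmetrizer rowSum colSum
  congr!

theorem isFilling_fill (μ : YoungDiagram) : IsFilling μ (rowOf μ) (colOf μ) where
  inj x y h₁ h₂ := (fill μ).injective (Subtype.ext (Prod.ext h₁ h₂))
  mem x := (fill μ x).2
  surj c hc := ⟨(fill μ).symm ⟨c, hc⟩, by simp [rowOf], by simp [colOf]⟩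

theorem rowSum_mul_single {row : X → ℕ} {p : Perm X} (hp : ∀ x, row (p x) = row x) :
    rowSum row * single p 1 = rowSum row := by
  unfold rowSum
  rw [Finset.sum_mul]
  refine Fintype.sum_equiv (Equiv.mulRight p) _ _ fun g => ?_
  have : (∀ x, row ((g * p) x) = row x) ↔ ∀ x, row (g x) = row x := by
    constructor
    · intro h x
      have h1 := h (p.symm x)
      have h2 := hp (p.symm x)
      simp only [Perm.mul_apply, apply_symm_apply] at h1 h2
      rw [h1, h2]
    · intro h x
      rw [Perm.mul_apply, h, hp]
  simp only [Equiv.coe_mulRight, this]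
  split_ifs <;> simp

theorem single_mul_colSum {col : X → ℕ} {q : Perm X} (hq : ∀ x, col (q x) = col x) :
    single q 1 * colSum col = ((Perm.sign q : ℤ) : ℚ) • colSum col := by
  unfold colSum
  rw [Finset.mul_sum, Finset.smul_sum]
  refine Fintype.sum_equiv (Equiv.mulLeft q) _ _ fun g => ?_
  have : (∀ x, col ((q * g) x) = col x) ↔ ∀ x, col (g x) = col x := by
    simp [hq]
  simp only [Equiv.coe_mulLeft, this]
  split_ifs
  · rw [single_mul_single, smul_single, one_mul, Perm.sign_mul]
    rcases Int.units_eq_one_or (Perm.sign q) with h | h <;> simp [h]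
  · simp

omit [DecidableEq X] in
theorem IsFilling.mem_of_row_injective {μ : YoungDiagram} {row col : X → ℕ}
    (h : IsFilling μ row col) (g : Perm X)
    (hg : ∀ x y, col x = col y → row (g x) = row (g y) → x = y) (z : X) :
    (row (g z), col z) ∈ μ := by
  rw [YoungDiagram.mem_iff_lt_colLen]
  by_contra! hz
  set r := μ.colLen (col z) with hr
  let A : Finset X := Finset.univ.filter fun x => row (g x) < r
  let B : Finset X := Finset.univ.filter fun x => row x < r
  have hAB : A.card = B.card := by
    refine Finset.card_bij (fun x _ => g x) ?_ ?_ ?_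
    · intro x hx; simpa [A, B] using hx
    · intro x _ y _ hxy; exact g.injective hxy
    · intro y hy; exact ⟨g⁻¹ y, by simpa [A, B] using hy, by simp⟩
  have hA := Finset.card_eq_sum_card_fiberwise (s := A) (f := col)
    (t := Finset.univ.image col) (by intro x _; simp)
  have hB := Finset.card_eq_sum_card_fiberwise (s := B) (f := col)
    (t := Finset.univ.image col) (by intro x _; simp)
  have hsub : ∀ j, μ.colLen j ≤ r → A.filter (fun x => col x = j) ⊆
      B.filter (fun x => col x = j) := by
    intro j hj x hx
    simp only [A, B, Finset.mem_filter, Finset.mem_univ, true_and] at hx ⊢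
    refine ⟨lt_of_lt_of_le ?_ hj, hx.2⟩
    have := h.mem x
    rwa [YoungDiagram.mem_iff_lt_colLen, hx.2] at this
  have hlt : ∑ j ∈ Finset.univ.image col, (A.filter (fun x => col x = j)).card <
      ∑ j ∈ Finset.univ.image col, (B.filter (fun x => col x = j)).card := by
    refine Finset.sum_lt_sum (fun j _ => ?_) ⟨col z, by simp, ?_⟩
    · rcases le_or_gt (μ.colLen j) r with hj | hj
      · exact Finset.card_le_card (hsub j hj)
      · have h1 : (A.filter (fun x => col x = j)).card ≤ (Finset.range r).card := by
          refine Finset.card_le_card_of_injOn (fun x => row (g x)) ?_ ?_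
          · intro x hx
            simp only [A, Finset.coe_filter, Finset.mem_filter, Finset.mem_univ, true_and,
              Set.mem_ofPred_eq] at hx
            simpa using hx.1
          · intro x hx y hy hxy
            simp only [A, Finset.coe_filter, Finset.mem_filter, Finset.mem_univ, true_and,
              Set.mem_ofPred_eq] at hx hy
            exact hg x y (hx.2.trans hy.2.symm) hxy
        refine h1.trans (Finset.card_le_card_of_surjOn row ?_)
        intro i hi
        have hi' : i < r := by simpa using hi
        obtain ⟨x, hx1, hx2⟩ := h.surj (i, j)
          (YoungDiagram.mem_iff_lt_colLen.2 (hi'.trans hj))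
        exact ⟨x, by simp [B, hx1, hx2, hi'], hx1⟩
    · refine Finset.card_lt_card ((Finset.ssubset_iff_of_subset (hsub _ le_rfl)).2 ⟨z, ?_, ?_⟩)
      · have := h.mem z
        rw [YoungDiagram.mem_iff_lt_colLen] at this
        simp [B, this, hr]
      · simp [A, hz]
  omega

omit [DecidableEq X] in
theorem IsFilling.exists_eq_mul {μ : YoungDiagram} {row col : X → ℕ}
    (h : IsFilling μ row col) (g : Perm X)
    (hg : ∀ x y, col x = col y → row (g x) = row (g y) → x = y) :
    ∃ p q : Perm X, (∀ x, row (p x) = row x) ∧ (∀ x, col (q x) = col x) ∧ g = p * q := by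
  choose f hf₁ hf₂ using fun z => h.surj _ (h.mem_of_row_injective g hg z)
  have hf : Function.Injective f := by
    intro x y hxy
    refine hg x y ?_ ?_
    · exact (hf₂ x).symm.trans (hxy ▸ hf₂ y)
    · exact (hf₁ x).symm.trans (hxy ▸ hf₁ y)
  let q : Perm X := Equiv.ofBijective f (Finite.injective_iff_bijective.1 hf)
  refine ⟨g * q⁻¹, q, fun x => ?_, fun x => hf₂ x, by simp⟩
  have := hf₁ (q⁻¹ x)
  have hq : f (q⁻¹ x) = x := q.apply_symm_apply x
  rw [hq] at this
  simpa using this.symm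

theorem IsFilling.rowSum_mul_mul_colSum {μ : YoungDiagram} {row col : X → ℕ}
    (h : IsFilling μ row col) (x : MonoidAlgebra ℚ (Perm X)) :
    ∃ κ : ℚ, rowSum row * x * colSum col = κ • symmetrizer row col := by
  induction x using MonoidAlgebra.induction_linear with
  | zero => exact ⟨0, by simp⟩
  | add x y hx hy =>
    obtain ⟨κ, hκ⟩ := hx
    obtain ⟨κ', hκ'⟩ := hy
    exact ⟨κ + κ', by rw [mul_add, add_mul, hκ, hκ', add_smul]⟩
  | single g r =>
    suffices ∃ κ : ℚ, rowSum row * single g 1 * colSum col = κ • symmetrizer row col by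
      obtain ⟨κ, hκ⟩ := this
      refine ⟨r * κ, ?_⟩
      have : single g r = r • single g (1 : ℚ) := by simp
      rw [this, mul_smul_comm, smul_mul_assoc, hκ, smul_smul]
    by_cases hg : ∀ x y, col x = col y → row (g x) = row (g y) → x = y
    · obtain ⟨p, q, hp, hq, rfl⟩ := h.exists_eq_mul g hg
      refine ⟨((Perm.sign q : ℤ) : ℚ), ?_⟩
      have : single (p * q) (1 : ℚ) = single p 1 * single q 1 := by simp
      rw [this, ← mul_assoc, rowSum_mul_single hp, mul_assoc, single_mul_colSum hq,
        mul_smul_comm, symmetrizer]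
    · push Not at hg
      obtain ⟨x, y, hc, hr, hxy⟩ := hg
      refine ⟨0, ?_⟩
      have hsw : ∀ (f : X → ℕ) (a b : X), f a = f b → ∀ z, f (swap a b z) = f z := by
        intro f a b hab z
        rw [swap_apply_def]
        split_ifs with h1 h2
        · rw [h1, hab]
        · rw [h2, hab]
        · rfl
      have h1 := rowSum_mul_single (hsw row (g x) (g y) hr)
      have h2 := single_mul_colSum (hsw col x y hc)
      have h3 : single (swap (g x) (g y)) (1 : ℚ) * single g 1 =
          single g 1 * single (swap x y) 1 := by
        rw [single_mul_single, single_mul_single, Equiv.mul_swap_eq_swap_mul]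
      have h4 : rowSum row * single g 1 * colSum col =
          -(rowSum row * single g 1 * colSum col) := by
        conv_lhs => rw [← h1, mul_assoc (rowSum row), h3, ← mul_assoc, mul_assoc _ _ (colSum col),
          h2, Perm.sign_swap hxy]
        simp
      rw [zero_smul]
      ext σ
      have h5 := congrArg (fun v => v.coeff σ) h4
      simp only [coeff_neg, Finsupp.neg_apply] at h5
      simpa using self_eq_neg.1 h5

theorem coeff_rowSum (row : X → ℕ) (g : Perm X) :
    (rowSum row).coeff g = if ∀ x, row (g x) = row x then 1 else 0 := by
  unfold rowSum
  rw [coeff_sum, Finsupp.finsetSum_apply, Finset.sum_eq_single g]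
  · split_ifs <;> simp
  · intro p _ hp
    split_ifs
    · simp [hp]
    · simp
  · simp

theorem coeff_symmetrizer (row col : X → ℕ) (g : Perm X) :
    (symmetrizer row col).coeff g = ∑ q : Perm X,
      if (∀ x, col (q x) = col x) ∧ ∀ x, row ((g * q⁻¹) x) = row x
      then ((Perm.sign q : ℤ) : ℚ) else 0 := by
  unfold symmetrizer colSum
  rw [Finset.mul_sum, coeff_sum, Finsupp.finsetSum_apply]
  refine Finset.sum_congr rfl fun q _ => ?_
  by_cases hq : ∀ x, col (q x) = col x
  · rw [if_pos hq, coeff_mul_single_apply, coeff_rowSum]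
    by_cases hr : ∀ x, row ((g * q⁻¹) x) = row x
    · rw [if_pos hr, if_pos ⟨hq, hr⟩, one_mul]
    · rw [if_neg hr, if_neg (fun h => hr h.2), zero_mul]
  · rw [if_neg hq, if_neg (fun h => hq h.1)]
    simp

omit [Fintype X] [DecidableEq X] in
theorem IsFilling.fixed_of_fixed {μ : YoungDiagram} {row col : X → ℕ}
    (h : IsFilling μ row col) {g q : Perm X} (hq : ∀ x, col (q x) = col x)
    (hp : ∀ x, row ((g * q⁻¹) x) = row x) {x : X} (hx : g x = x) : q x = x := by
  refine h.inj _ _ ?_ (hq x)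
  have := hp (q x)
  simpa [hx] using this.symm

theorem IsFilling.coeff_symmetrizer_one {μ : YoungDiagram} {row col : X → ℕ}
    (h : IsFilling μ row col) : (symmetrizer row col).coeff 1 = 1 := by
  rw [coeff_symmetrizer, Finset.sum_eq_single 1]
  · simp
  · intro q _ hq
    rw [if_neg]
    rintro ⟨h1, h2⟩
    exact hq (Equiv.ext fun x => h.fixed_of_fixed h1 h2 rfl)
  · simp

theorem IsFilling.coeff_symmetrizer_swap {μ : YoungDiagram} {row col : X → ℕ}
    (h : IsFilling μ row col) {x y : X} (hxy : x ≠ y) :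
    (symmetrizer row col).coeff (swap x y) =
      (if row x = row y then 1 else 0) - (if col x = col y then 1 else 0) := by
  have hsw : ∀ (f : X → ℕ), (∀ z, f (swap x y z) = f z) ↔ f x = f y := by
    intro f
    constructor
    · intro hf
      simpa using hf y
    · intro hab z
      rw [swap_apply_def]
      split_ifs with h1 h2
      · rw [h1, hab]
      · rw [h2, hab]
      · rfl
  have hne : (1 : Perm X) ≠ swap x y := fun he => hxy (swap_eq_one_iff.1 he.symm)
  rw [coeff_symmetrizer, ← Finset.sum_subset (Finset.subset_univ {1, swap x y}),
    Finset.sum_pair hne]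
  · simp only [Perm.one_apply, inv_one, mul_one, hsw, Perm.sign_one, swap_inv, swap_mul_self,
      Perm.sign_swap hxy]
    split_ifs <;> simp_all
  · intro q _ hq
    rw [if_neg]
    rintro ⟨h1, h2⟩
    have hfix : ∀ z, z ≠ x → z ≠ y → q z = z := fun z hzx hzy =>
      h.fixed_of_fixed h1 h2 (swap_apply_of_ne_of_ne hzx hzy)
    apply hq
    simp only [Finset.mem_insert, Finset.mem_singleton]
    have hqx : q x = x ∨ q x = y := by
      by_contra! hcon
      exact hcon.1 (q.injective (hfix _ hcon.1 hcon.2))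
    have hqy : q y = x ∨ q y = y := by
      by_contra! hcon
      exact hcon.2 (q.injective (hfix _ hcon.1 hcon.2))
    rcases hqx with hqx | hqx
    · left
      have hqy' : q y = y := hqy.resolve_left fun hh => hxy (q.injective (hqx.trans hh.symm))
      ext z
      by_cases hzx : z = x
      · simp [hzx, hqx]
      by_cases hzy : z = y
      · simp [hzy, hqy']
      simp [hfix z hzx hzy]
    · right
      have hqy' : q y = x := hqy.resolve_right fun hh => hxy (q.injective (hqx.trans hh.symm))
      ext z
      by_cases hzx : z = x
      · simp [hzx, hqx]
      by_cases hzy : z = y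
      · simp [hzy, hqy']
      simp [hfix z hzx hzy, swap_apply_of_ne_of_ne hzx hzy]

theorem trace_mulRight (c : MonoidAlgebra ℚ (Perm X)) :
    LinearMap.trace ℚ _ (LinearMap.mulRight ℚ c) = Fintype.card (Perm X) * c.coeff 1 := by
  let b := MonoidAlgebra.basis (Perm X) ℚ
  have hb : ∀ g, b g = single g 1 := fun g => rfl
  have hr : ∀ x, b.repr x = x.coeff := fun x => rfl
  rw [LinearMap.trace_eq_matrix_trace ℚ b, Matrix.trace]
  simp [LinearMap.toMatrix_apply, hb, hr, coeff_single_mul_apply]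

theorem IsFilling.symmetrizer_mul_self_ne_zero {μ : YoungDiagram} {row col : X → ℕ}
    (h : IsFilling μ row col) : symmetrizer row col * symmetrizer row col ≠ 0 := by
  intro h0
  have hn : IsNilpotent (LinearMap.mulRight ℚ (symmetrizer row col)) := by
    refine ⟨2, LinearMap.ext fun x => ?_⟩
    simp [pow_two, mul_assoc, h0]
  have := (LinearMap.isNilpotent_trace_of_isNilpotent hn).eq_zero
  rw [trace_mulRight, h.coeff_symmetrizer_one] at this
  simp [Fintype.card_ne_zero] at this

theorem IsFilling.eq_coeff_smul {μ : YoungDiagram} {row col : X → ℕ}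
    (h : IsFilling μ row col) {x : MonoidAlgebra ℚ (Perm X)} {κ : ℚ}
    (hx : x = κ • symmetrizer row col) : x = x.coeff 1 • symmetrizer row col := by
  conv_rhs => rw [hx, coeff_smul_apply, h.coeff_symmetrizer_one, smul_eq_mul, mul_one]
  exact hx

theorem IsFilling.symmetrizer_mul_mul_symmetrizer {μ : YoungDiagram} {row col : X → ℕ}
    (h : IsFilling μ row col) (x : MonoidAlgebra ℚ (Perm X)) :
    symmetrizer row col * x * symmetrizer row col =
      (symmetrizer row col * x * symmetrizer row col).coeff 1 • symmetrizer row col := by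
  obtain ⟨κ, hκ⟩ := h.rowSum_mul_mul_colSum (colSum col * x * rowSum row)
  refine h.eq_coeff_smul (κ := κ) ?_
  rw [← hκ]
  simp only [symmetrizer, mul_assoc]

theorem IsFilling.coeff_symmetrizer_mul_self_ne_zero {μ : YoungDiagram} {row col : X → ℕ}
    (h : IsFilling μ row col) : (symmetrizer row col * symmetrizer row col).coeff 1 ≠ 0 := by
  intro h0
  have := h.symmetrizer_mul_mul_symmetrizer 1
  rw [mul_one, h0, zero_smul] at this
  exact h.symmetrizer_mul_self_ne_zero this

theorem IsFilling.central_mul_symmetrizer {μ : YoungDiagram} {row col : X → ℕ}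
    (h : IsFilling μ row col) {z : MonoidAlgebra ℚ (Perm X)} (hz : ∀ x, z * x = x * z) :
    z * symmetrizer row col = (z * symmetrizer row col).coeff 1 • symmetrizer row col := by
  have h1 := h.symmetrizer_mul_mul_symmetrizer 1
  have h2 := h.symmetrizer_mul_mul_symmetrizer z
  have hne := h.coeff_symmetrizer_mul_self_ne_zero
  rw [mul_one] at h1
  rw [← hz (symmetrizer row col), mul_assoc] at h2
  generalize (z * (symmetrizer row col * symmetrizer row col)).coeff 1 = β at h2
  generalize (symmetrizer row col * symmetrizer row col).coeff 1 = α at h1 hne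
  refine h.eq_coeff_smul (κ := α⁻¹ * β) ?_
  rw [mul_smul, ← h2, h1, mul_smul_comm, inv_smul_smul₀ hne]

end Symmetrizer

section EmbSum

open Equiv MonoidAlgebra

theorem viaEmbedding_eq_of {α β : Type*} {π : Perm α} {f : α ↪ β} {σ : Perm β}
    (h₁ : ∀ x, σ (f x) = f (π x)) (h₂ : ∀ y, y ∉ Set.range f → σ y = y) :
    π.viaEmbedding f = σ := by
  ext y
  by_cases hy : y ∈ Set.range f
  · obtain ⟨x, rfl⟩ := hy
    rw [Perm.viaEmbedding_apply, h₁]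
  · rw [Perm.viaEmbedding_apply_of_notMem _ _ _ hy, h₂ y hy]

theorem viaEmbedding_mul {α β : Type*} (π σ : Perm α) (f : α ↪ β) :
    (π * σ).viaEmbedding f = π.viaEmbedding f * σ.viaEmbedding f :=
  map_mul (Perm.viaEmbeddingHom f) π σ

theorem viaEmbedding_one {α β : Type*} (f : α ↪ β) : (1 : Perm α).viaEmbedding f = 1 :=
  map_one (Perm.viaEmbeddingHom f)

theorem viaEmbedding_viaEmbedding {α β γ : Type*} (π : Perm α) (f : α ↪ β) (g : β ↪ γ) :
    (π.viaEmbedding f).viaEmbedding g = π.viaEmbedding (f.trans g) := by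
  symm
  refine viaEmbedding_eq_of (fun x => ?_) fun z hz => ?_
  · simp [Perm.viaEmbedding_apply]
  · by_cases hg : z ∈ Set.range g
    · obtain ⟨y, rfl⟩ := hg
      rw [Perm.viaEmbedding_apply, Perm.viaEmbedding_apply_of_notMem]
      rintro ⟨x, rfl⟩
      exact hz ⟨x, rfl⟩
    · rw [Perm.viaEmbedding_apply_of_notMem _ _ _ hg]

theorem viaEmbedding_swap {α β : Type*} [DecidableEq α] [DecidableEq β] (a b : α) (f : α ↪ β) :
    (swap a b).viaEmbedding f = swap (f a) (f b) := by
  refine viaEmbedding_eq_of (fun x => (f.injective.map_swap a b x).symm) fun y hy => ?_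
  exact swap_apply_of_ne_of_ne (fun h => hy ⟨a, h.symm⟩) (fun h => hy ⟨b, h.symm⟩)

theorem viaEmbedding_optionCongr {α β : Type*} (π : Perm α) (f : α ↪ β) :
    Perm.viaEmbedding (optionCongr π : Perm (Option α)) f.optionMap =
      (optionCongr (π.viaEmbedding f) : Perm (Option β)) := by
  refine viaEmbedding_eq_of (fun x => ?_) fun y hy => ?_
  · cases x <;> simp [Perm.viaEmbedding_apply]
  · cases y with
    | none => rfl
    | some y =>
      have : y ∉ Set.range f := by
        rintro ⟨x, rfl⟩
        exact hy ⟨some x, rfl⟩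
      simp [Perm.viaEmbedding_apply_of_notMem _ _ _ this]

theorem viaEmbedding_trans_equiv {α β γ : Type*} (π : Perm α) (f : α ↪ β) (e : β ≃ γ) :
    π.viaEmbedding (f.trans e.toEmbedding) = e.permCongr (π.viaEmbedding f) := by
  refine viaEmbedding_eq_of (fun x => ?_) fun y hy => ?_
  · simp [permCongr_apply, Perm.viaEmbedding_apply]
  · rw [permCongr_apply, Perm.viaEmbedding_apply_of_notMem, apply_symm_apply]
    rintro ⟨x, hx⟩
    exact hy ⟨x, by simp [hx]⟩

theorem permCongr_viaEmbedding {α β γ : Type*} (π : Perm α) (e : α ≃ β) (f : β ↪ γ) :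
    (e.permCongr π).viaEmbedding f = π.viaEmbedding (e.toEmbedding.trans f) := by
  symm
  refine viaEmbedding_eq_of (fun x => ?_) fun y hy => ?_
  · simp [Perm.viaEmbedding_apply]
  · rw [Perm.viaEmbedding_apply_of_notMem]
    rintro ⟨x, rfl⟩
    exact hy ⟨e.symm x, by simp⟩

/-- The sum, over all embeddings of `ι` in `X`, of the corresponding copies of `π`. -/
noncomputable def embSum (X : Type*) {ι : Type*} (π : Perm ι) : MonoidAlgebra ℚ (Perm X) :=
  ∑ᶠ f : ι ↪ X, single (π.viaEmbedding f) 1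

theorem embSum_eq_sum {X ι : Type*} [Fintype (ι ↪ X)] (π : Perm ι) :
    embSum X π = ∑ f : ι ↪ X, single (π.viaEmbedding f) (1 : ℚ) :=
  finsum_eq_sum_of_fintype _

theorem embSum_permCongr {X ι κ : Type*} (e : ι ≃ κ) (π : Perm ι) :
    embSum X (e.permCongr π) = embSum X π := by
  unfold embSum
  refine finsum_eq_of_bijective (fun f => e.toEmbedding.trans f) ?_ fun f => ?_
  · refine ⟨fun f g h => ?_, fun f => ⟨e.symm.toEmbedding.trans f, ?_⟩⟩
    · ext x
      simpa using DFunLike.congr_fun h (e.symm x)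
    · ext x
      simp
  · rw [permCongr_viaEmbedding]

theorem embSum_central {X ι : Type*} [Finite X] [Finite ι] (π : Perm ι)
    (x : MonoidAlgebra ℚ (Perm X)) : embSum X π * x = x * embSum X π := by
  have := Fintype.ofFinite (ι ↪ X)
  induction x using MonoidAlgebra.induction_linear with
  | zero => simp
  | add x y hx hy => rw [mul_add, add_mul, hx, hy]
  | single g r =>
    rw [embSum_eq_sum, Finset.sum_mul, Finset.mul_sum]
    symm
    let E : (ι ↪ X) ≃ (ι ↪ X) :=
      { toFun := fun f => f.trans g.toEmbedding
        invFun := fun f => f.trans g.symm.toEmbedding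
        left_inv := fun f => by ext; simp
        right_inv := fun f => by ext; simp }
    refine Fintype.sum_equiv E _ _ fun f => ?_
    rw [single_mul_single, single_mul_single]
    change single _ _ = single (π.viaEmbedding (f.trans g.toEmbedding) * g) _
    rw [viaEmbedding_trans_equiv]
    congr 1
    · ext x
      simp
    · ring

theorem sum_embedding {X ι M : Type*} [Fintype (ι ↪ X)] [Fintype (ι → X)] [AddCommMonoid M]
    (F : (ι ↪ X) → M) [∀ u : ι → X, Decidable (Function.Injective u)] :
    ∑ f, F f = ∑ u : ι → X, if h : Function.Injective u then F ⟨u, h⟩ else 0 := by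
  symm
  refine Finset.sum_bij_ne_zero (fun u _ hu => ⟨u, ?_⟩) ?_ ?_ ?_ ?_
  · by_contra h
    exact hu (dif_neg h)
  · simp
  · intro u _ _ v _ _ h
    exact congrArg (fun f : ι ↪ X => (f : ι → X)) h
  · intro f _ hf
    exact ⟨f, Finset.mem_univ _, by simpa [f.injective] using hf, rfl⟩
  · intro u _ hu
    have : Function.Injective u := by
      by_contra h
      exact hu (dif_neg h)
    simp [this]

instance setoid_finite {T : Type*} [Finite T] : Finite (Setoid T) :=
  Finite.of_injective (fun r : Setoid T => fun a b => r a b)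
    fun _ _ h => Setoid.ext fun a b => iff_of_eq (congrFun (congrFun h a) b)

noncomputable instance setoidFintype {T : Type*} [Finite T] : Fintype (Setoid T) :=
  Fintype.ofFinite _

theorem sum_fun_eq_sum_setoid {T X M : Type*} [Fintype (T → X)] [Fintype (Setoid T)]
    [∀ r : Setoid T, Fintype (Quotient r ↪ X)] [AddCommMonoid M] (Φ : (T → X) → M) :
    ∑ u, Φ u = ∑ r : Setoid T, ∑ h : Quotient r ↪ X, Φ (fun t => h (Quotient.mk r t)) := by
  rw [← Fintype.sum_sigma' (fun r (h : Quotient r ↪ X) => Φ (fun t => h (Quotient.mk r t)))]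
  symm
  refine Fintype.sum_bijective
    (fun p : (Σ r : Setoid T, Quotient r ↪ X) => fun t => p.2 (Quotient.mk p.1 t)) ⟨?_, ?_⟩ _ _
    fun _ => rfl
  · rintro ⟨r, h⟩ ⟨r', h'⟩ heq
    dsimp only at heq
    have hr : r = r' := by
      ext a b
      have h1 := congrFun heq a
      have h2 := congrFun heq b
      rw [← Quotient.eq (r := r), ← Quotient.eq (r := r'), ← h.injective.eq_iff,
        ← h'.injective.eq_iff, h1, h2]
    subst hr
    congr 1
    ext q
    induction q using Quotient.inductionOn with
    | h a => exact congrFun heq a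
  · intro u
    refine ⟨⟨Setoid.ker u, ⟨Quotient.lift u fun a b h => h, ?_⟩⟩, rfl⟩
    intro a b
    induction a using Quotient.inductionOn
    induction b using Quotient.inductionOn
    exact fun h => Quotient.sound h

/-- The product of the copies of `π` and `σ` in a quotient of `ι ⊕ κ`. -/
noncomputable def glue {ι κ : Type*} (π : Perm ι) (σ : Perm κ) {Y : Type*} (u : ι ⊕ κ → Y)
    (h : Function.Injective (u ∘ Sum.inl) ∧ Function.Injective (u ∘ Sum.inr)) : Perm Y :=
  π.viaEmbedding ⟨_, h.1⟩ * σ.viaEmbedding ⟨_, h.2⟩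

theorem glue_viaEmbedding {ι κ : Type*} (π : Perm ι) (σ : Perm κ) {Y X : Type*} (u : ι ⊕ κ → Y)
    (h : Function.Injective (u ∘ Sum.inl) ∧ Function.Injective (u ∘ Sum.inr)) (f : Y ↪ X)
    (h' : Function.Injective ((f ∘ u) ∘ Sum.inl) ∧ Function.Injective ((f ∘ u) ∘ Sum.inr)) :
    (glue π σ u h).viaEmbedding f = glue π σ (f ∘ u) h' := by
  unfold glue
  rw [viaEmbedding_mul, viaEmbedding_viaEmbedding, viaEmbedding_viaEmbedding]
  rfl

open Classical in
theorem embSum_mul_embSum {X ι κ : Type*} [Fintype X] [Fintype ι] [Fintype κ]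
    (π : Perm ι) (σ : Perm κ) :
    embSum X π * embSum X σ = ∑ r : Setoid (ι ⊕ κ),
      if h : Function.Injective (Quotient.mk r ∘ Sum.inl) ∧
        Function.Injective (Quotient.mk r ∘ Sum.inr)
      then embSum X (glue π σ (Quotient.mk r) h) else 0 := by
  have key : embSum X π * embSum X σ = ∑ u : ι ⊕ κ → X,
      if h : Function.Injective (u ∘ Sum.inl) ∧ Function.Injective (u ∘ Sum.inr)
      then single (glue π σ u h) (1 : ℚ) else 0 := by
    rw [embSum_eq_sum, embSum_eq_sum, Finset.sum_mul_sum, sum_embedding,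
      ← Fintype.sum_equiv (Equiv.sumArrowEquivProdArrow ι κ X).symm _ _ fun _ => rfl,
      Fintype.sum_prod_type]
    refine Finset.sum_congr rfl fun u _ => ?_
    by_cases hu : Function.Injective u
    · rw [dif_pos hu, sum_embedding]
      refine Finset.sum_congr rfl fun v _ => ?_
      by_cases hv : Function.Injective v
      · rw [dif_pos hv, dif_pos ⟨hu, hv⟩, single_mul_single, one_mul]
        rfl
      · rw [dif_neg hv, dif_neg fun h => hv h.2]
    · rw [dif_neg hu]
      exact (Finset.sum_eq_zero fun v _ => dif_neg fun h => hu h.1).symm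
  rw [key, sum_fun_eq_sum_setoid]
  refine Finset.sum_congr rfl fun r _ => ?_
  by_cases h : Function.Injective (Quotient.mk r ∘ Sum.inl) ∧
      Function.Injective (Quotient.mk r ∘ Sum.inr)
  · rw [dif_pos h, embSum_eq_sum]
    refine Finset.sum_congr rfl fun f _ => ?_
    have h' := h.imp f.injective.comp f.injective.comp
    rw [glue_viaEmbedding π σ _ h f h']
    exact dif_pos h'
  · rw [dif_neg h]
    refine Finset.sum_eq_zero fun f _ => dif_neg fun h' => h ⟨?_, ?_⟩
    · exact Function.Injective.of_comp (f := f) h'.1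
    · exact Function.Injective.of_comp (f := f) h'.2

theorem glue_equiv {ι κ Y : Type*} (π : Perm ι) (σ : Perm κ) (e : ι ⊕ κ ≃ Y)
    (h : Function.Injective (e ∘ Sum.inl) ∧ Function.Injective (e ∘ Sum.inr)) :
    glue π σ e h = e.permCongr (Perm.sumCongr π σ) := by
  have h1 : π.viaEmbedding ⟨_, h.1⟩ = e.permCongr (Perm.sumCongr π 1) := by
    refine viaEmbedding_eq_of (fun x => ?_) fun y hy => ?_
    · simp
    · obtain ⟨x, rfl⟩ := e.surjective y
      cases x with
      | inl x => exact absurd ⟨x, rfl⟩ hy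
      | inr x => simp
  have h2 : σ.viaEmbedding ⟨_, h.2⟩ = e.permCongr (Perm.sumCongr 1 σ) := by
    refine viaEmbedding_eq_of (fun x => ?_) fun y hy => ?_
    · simp
    · obtain ⟨x, rfl⟩ := e.surjective y
      cases x with
      | inr x => exact absurd ⟨x, rfl⟩ hy
      | inl x => simp
  unfold glue
  rw [h1, h2]
  ext y
  obtain ⟨x, rfl⟩ := e.surjective y
  cases x <;> simp

end EmbSum

section NormChar

open Equiv MonoidAlgebra

variable {X : Type*} [Fintype X] [DecidableEq X]

/-- The scalar by which the sum of the copies of `π` acts on a Young symmetrizer. -/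
noncomputable def fillingChar (row col : X → ℕ) {ι : Type*} (π : Perm ι) : ℚ :=
  (embSum X π * symmetrizer row col).coeff 1

theorem IsFilling.embSum_mul_symmetrizer {μ : YoungDiagram} {row col : X → ℕ}
    (h : IsFilling μ row col) {ι : Type*} [Finite ι] (π : Perm ι) :
    embSum X π * symmetrizer row col = fillingChar row col π • symmetrizer row col :=
  h.central_mul_symmetrizer (embSum_central π)

theorem fillingChar_permCongr (row col : X → ℕ) {ι κ : Type*} (e : ι ≃ κ) (π : Perm ι) :
    fillingChar row col (e.permCongr π) = fillingChar row col π := by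
  unfold fillingChar
  rw [embSum_permCongr]

theorem fillingChar_eq_sum (row col : X → ℕ) {ι : Type*} [Fintype (ι ↪ X)] (π : Perm ι) :
    fillingChar row col π =
      ∑ f : ι ↪ X, (symmetrizer row col).coeff (π.viaEmbedding f)⁻¹ := by
  unfold fillingChar
  rw [embSum_eq_sum, Finset.sum_mul, coeff_sum, Finsupp.finsetSum_apply]
  refine Finset.sum_congr rfl fun f _ => ?_
  rw [coeff_single_mul_apply]
  simp

theorem coeff_symmetrizer_comp {Y : Type*} [Fintype Y] [DecidableEq Y] (row col : Y → ℕ)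
    (e : X ≃ Y) (g : Perm X) :
    (symmetrizer (row ∘ e) (col ∘ e)).coeff g = (symmetrizer row col).coeff (e.permCongr g) := by
  rw [coeff_symmetrizer, coeff_symmetrizer]
  refine Fintype.sum_equiv e.permCongr _ _ fun q => ?_
  have h1 : (∀ x, (col ∘ e) (q x) = (col ∘ e) x) ↔ ∀ y, col (e.permCongr q y) = col y := by
    rw [e.forall_congr_left]
    simp
  have h2 : (∀ x, (row ∘ e) ((g * q⁻¹) x) = (row ∘ e) x) ↔
      ∀ y, row ((e.permCongr g * (e.permCongr q)⁻¹) y) = row y := by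
    have h3 : (e.permCongr q)⁻¹ = e.permCongr q⁻¹ := rfl
    rw [e.forall_congr_left, h3]
    simp
  simp only [h1, h2, Perm.sign_permCongr]

theorem fillingChar_comp {Y : Type*} [Fintype Y] [DecidableEq Y] (row col : Y → ℕ)
    (e : X ≃ Y) {ι : Type*} [Finite ι] (π : Perm ι) :
    fillingChar (row ∘ e) (col ∘ e) π = fillingChar row col π := by
  have := Fintype.ofFinite (ι ↪ X)
  have := Fintype.ofFinite (ι ↪ Y)
  rw [fillingChar_eq_sum, fillingChar_eq_sum]
  refine Fintype.sum_equiv (Equiv.embeddingCongr (Equiv.refl ι) e) _ _ fun f => ?_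
  rw [coeff_symmetrizer_comp]
  congr 1
  have : Equiv.embeddingCongr (Equiv.refl ι) e f = f.trans e.toEmbedding := by
    ext; simp
  rw [this, viaEmbedding_trans_equiv]
  rfl

omit [Fintype X] [DecidableEq X] in
theorem IsFilling.exists_equiv {μ : YoungDiagram} {row col : X → ℕ} (h : IsFilling μ row col)
    {Y : Type*} {row' col' : Y → ℕ} (h' : IsFilling μ row' col') :
    ∃ e : X ≃ Y, row' ∘ e = row ∧ col' ∘ e = col := by
  choose e he using fun x => h'.surj _ (h.mem x)
  refine ⟨Equiv.ofBijective e ⟨fun x y hxy => ?_, fun y => ?_⟩, ?_, ?_⟩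
  · exact h.inj _ _ ((he x).1.symm.trans (hxy ▸ (he y).1))
      ((he x).2.symm.trans (hxy ▸ (he y).2))
  · obtain ⟨x, hx⟩ := h.surj _ (h'.mem y)
    exact ⟨x, h'.inj _ _ ((he x).1.trans hx.1) ((he x).2.trans hx.2)⟩
  · exact funext fun x => (he x).1
  · exact funext fun x => (he x).2

theorem IsFilling.fillingChar_eq {μ : YoungDiagram} {row col : X → ℕ} (h : IsFilling μ row col)
    {Y : Type*} [Fintype Y] [DecidableEq Y] {row' col' : Y → ℕ} (h' : IsFilling μ row' col')
    {ι : Type*} [Finite ι] (π : Perm ι) :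
    fillingChar row col π = fillingChar row' col' π := by
  obtain ⟨e, rfl, rfl⟩ := h.exists_equiv h'
  exact fillingChar_comp _ _ e π

/-- The normalized character of `π`, as a function of the Young diagram. -/
noncomputable def sigma {ι : Type*} (π : Perm ι) (μ : YoungDiagram) : ℚ :=
  fillingChar (rowOf μ) (colOf μ) π

theorem sigma_permCongr {ι κ : Type*} (e : ι ≃ κ) (π : Perm ι) :
    sigma (e.permCongr π) = sigma π :=
  funext fun _ => fillingChar_permCongr _ _ e π

/-- Left multiplication on the Specht module. -/
noncomputable def spechtMul (μ : YoungDiagram) (x : MonoidAlgebra ℚ (Perm (Fin μ.card))) :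
    spechtModule μ →ₗ[ℚ] spechtModule μ :=
  (LinearMap.mulLeft ℚ x).restrict (p := spechtModule μ) (q := spechtModule μ) (by
    rintro _ ⟨y, rfl⟩
    exact ⟨x * y, by simp [mul_assoc]⟩)

theorem spechtMul_mul (μ : YoungDiagram) (x y : MonoidAlgebra ℚ (Perm (Fin μ.card))) :
    spechtMul μ (x * y) = spechtMul μ x * spechtMul μ y :=
  LinearMap.ext fun v => Subtype.ext (mul_assoc x y v)

theorem spechtMul_one (μ : YoungDiagram) : spechtMul μ 1 = 1 :=
  LinearMap.ext fun v => Subtype.ext (one_mul v.1)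

theorem spechtMul_sum (μ : YoungDiagram) {ι : Type*} (s : Finset ι)
    (x : ι → MonoidAlgebra ℚ (Perm (Fin μ.card))) :
    spechtMul μ (∑ i ∈ s, x i) = ∑ i ∈ s, spechtMul μ (x i) := by
  refine LinearMap.ext fun v => Subtype.ext ?_
  rw [LinearMap.sum_apply, Submodule.coe_sum]
  exact Finset.sum_mul ..

theorem irrChar_eq (μ : YoungDiagram) (π : Perm (Fin μ.card)) :
    irrChar μ π = LinearMap.trace ℚ _ (spechtMul μ (single π 1)) :=
  rfl

theorem irrChar_conj (μ : YoungDiagram) (g π : Perm (Fin μ.card)) :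
    irrChar μ (g * π * g⁻¹) = irrChar μ π := by
  have h : single (g * π * g⁻¹) (1 : ℚ) = single g 1 * single π 1 * single g⁻¹ 1 := by
    simp [single_mul_single]
  rw [irrChar_eq, h, spechtMul_mul, LinearMap.trace_mul_comm, ← spechtMul_mul, ← mul_assoc,
    single_mul_single, inv_mul_cancel, one_mul, ← MonoidAlgebra.one_def, one_mul, irrChar_eq]

theorem irrChar_one_ne_zero (μ : YoungDiagram) : irrChar μ 1 ≠ 0 := by
  rw [irrChar_eq, ← MonoidAlgebra.one_def, spechtMul_one, LinearMap.trace_one]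
  have hc : youngSymmetrizer μ ≠ 0 := by
    intro h
    have := (isFilling_fill μ).coeff_symmetrizer_one
    rw [← youngSymmetrizer_eq, h] at this
    simp at this
  have : Nontrivial (spechtModule μ) :=
    ⟨⟨⟨youngSymmetrizer μ, 1, by simp⟩, 0, fun h => hc (congrArg Subtype.val h)⟩⟩
  exact_mod_cast Module.finrank_pos.ne'

theorem spechtMul_embSum (μ : YoungDiagram) {ι : Type*} [Finite ι] (π : Perm ι) :
    spechtMul μ (embSum _ π) = sigma π μ • LinearMap.id := by
  refine LinearMap.ext fun ⟨v, y, hy⟩ => Subtype.ext ?_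
  change embSum _ π * v = sigma π μ • v
  rw [← hy]
  simp only [LinearMap.mulRight_apply]
  rw [← mul_assoc, embSum_central, mul_assoc, youngSymmetrizer_eq,
    (isFilling_fill μ).embSum_mul_symmetrizer, mul_smul_comm]
  rfl

theorem normChar_eq_sigma {k : ℕ} (μ : YoungDiagram) (π : Perm (Fin k)) :
    normChar μ π = sigma π μ := by
  unfold normChar
  split_ifs with h
  · have hsum := congrArg (LinearMap.trace ℚ _) (spechtMul_embSum μ π)
    rw [embSum_eq_sum, spechtMul_sum, map_sum, map_smul,
      ← Module.End.one_eq_id, ← spechtMul_one, MonoidAlgebra.one_def, ← irrChar_eq,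
      smul_eq_mul] at hsum
    rw [div_eq_iff (irrChar_one_ne_zero μ), ← hsum,
      Finset.sum_congr rfl (g := fun _ => irrChar μ (π.viaEmbedding (Fin.castLEEmb h)))]
    · simp [Fintype.card_embedding_eq]
    · intro f _
      have := Perm.isMultiplyPretransitive (Fin μ.card) k
      obtain ⟨g, hg⟩ := MulAction.exists_smul_eq (Perm (Fin μ.card)) (Fin.castLEEmb h) f
      have hg' : (Fin.castLEEmb h).trans g.toEmbedding = f := by
        ext x
        rw [← hg, Function.Embedding.smul_apply]
        rfl
      rw [← irrChar_eq, ← hg', viaEmbedding_trans_equiv, 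
        ← irrChar_conj μ g (π.viaEmbedding (Fin.castLEEmb h))]
      congr 1
  · have : IsEmpty (Fin k ↪ Fin μ.card) := by
      refine ⟨fun f => h ?_⟩
      simpa using Fintype.card_le_of_embedding f
    unfold sigma
    rw [fillingChar_eq_sum]
    simp

end NormChar

section Product

open Equiv MonoidAlgebra

theorem card_quotient_lt {T : Type*} [Finite T] {r : Setoid T} (hr : r ≠ ⊥) :
    Nat.card (Quotient r) < Nat.card T := by
  refine lt_of_le_of_ne (Nat.card_le_card_of_surjective _ Quotient.mk_surjective) fun h => hr ?_
  have hb := (Function.Surjective.bijective_of_nat_card_le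
    (Quotient.mk_surjective (s := r)) h.ge)
  exact Setoid.ext fun a b => ⟨fun hab => hb.1 (Quotient.sound hab), fun hab => hab ▸ r.refl a⟩

open Classical in
theorem sigma_mul_sigma {ι κ : Type*} [Fintype ι] [Fintype κ] (π : Perm ι) (σ : Perm κ) :
    sigma π * sigma σ = ∑ r : Setoid (ι ⊕ κ),
      if h : Function.Injective (Quotient.mk r ∘ Sum.inl) ∧
        Function.Injective (Quotient.mk r ∘ Sum.inr)
      then sigma (glue π σ (Quotient.mk r) h) else 0 := by
  funext μ
  have h := isFilling_fill μ
  have h1 : (embSum _ π * embSum _ σ * symmetrizer (rowOf μ) (colOf μ)).coeff 1 =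
      sigma π μ * sigma σ μ := by
    rw [mul_assoc, h.embSum_mul_symmetrizer, mul_smul_comm, h.embSum_mul_symmetrizer,
      coeff_smul_apply, coeff_smul_apply, h.coeff_symmetrizer_one]
    simp only [smul_eq_mul, mul_one]
    exact mul_comm _ _
  rw [Pi.mul_apply, ← h1, embSum_mul_embSum, Finset.sum_mul, coeff_sum,
    Finsupp.finsetSum_apply, Finset.sum_apply]
  refine Finset.sum_congr rfl fun r _ => ?_
  split_ifs
  · rfl
  · simp

open Classical in
theorem sigma_sumCongr {ι κ : Type*} [Fintype ι] [Fintype κ] (π : Perm ι) (σ : Perm κ) :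
    sigma (Perm.sumCongr π σ) = sigma π * sigma σ - ∑ r : Setoid (ι ⊕ κ) with r ≠ ⊥,
      if h : Function.Injective (Quotient.mk r ∘ Sum.inl) ∧
        Function.Injective (Quotient.mk r ∘ Sum.inr)
      then sigma (glue π σ (Quotient.mk r) h) else 0 := by
  let e : ι ⊕ κ ≃ Quotient (⊥ : Setoid (ι ⊕ κ)) :=
    Equiv.ofBijective (Quotient.mk _) ⟨fun a b h => Quotient.exact h, Quotient.mk_surjective⟩
  have he : Function.Injective (e ∘ Sum.inl) ∧ Function.Injective (e ∘ Sum.inr) :=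
    ⟨e.injective.comp Sum.inl_injective, e.injective.comp Sum.inr_injective⟩
  rw [eq_sub_iff_add_eq, sigma_mul_sigma, Finset.filter_ne', add_comm,
    ← Finset.sum_erase_add _ _ (Finset.mem_univ (⊥ : Setoid (ι ⊕ κ)))]
  congr 1
  rw [dif_pos (by exact he), ← sigma_permCongr e, ← glue_equiv π σ e he]
  rfl

end Product

section JucysMurphy

open Equiv MonoidAlgebra

/-- `optionCongr` as a group homomorphism. -/
def optionCongrHom (X : Type*) : Perm X →* Perm (Option X) where
  toFun := optionCongr
  map_one' := optionCongr_one
  map_mul' g h := by ext x; cases x <;> rfl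

/-- The embedding of group algebras induced by `optionCongr`. -/
noncomputable def optionLift (X : Type*) :
    MonoidAlgebra ℚ (Perm X) →ₐ[ℚ] MonoidAlgebra ℚ (Perm (Option X)) :=
  MonoidAlgebra.mapDomainAlgHom ℚ ℚ (optionCongrHom X)

theorem optionLift_single {X : Type*} (g : Perm X) (a : ℚ) :
    optionLift X (single g a) = single (optionCongr g : Perm (Option X)) a := by
  simp [optionLift]
  rfl

variable {X : Type*} [Fintype X] [DecidableEq X]

/-- The projection of the group algebra of `Perm (Option X)` on that of `Perm X`. -/
noncomputable def optionProj (X : Type*) [Fintype X] [DecidableEq X] :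
    MonoidAlgebra ℚ (Perm (Option X)) →ₗ[ℚ] MonoidAlgebra ℚ (Perm X) where
  toFun x := ∑ g : Perm X, single g (x.coeff (optionCongr g))
  map_add' x y := by simp [Finset.sum_add_distrib]
  map_smul' a x := by simp [Finset.smul_sum, smul_single]

theorem coeff_optionProj (x : MonoidAlgebra ℚ (Perm (Option X))) (g : Perm X) :
    (optionProj X x).coeff g = x.coeff (optionCongr g) := by
  change (∑ h : Perm X, single h (x.coeff (optionCongr h))).coeff g = _
  rw [coeff_sum, Finsupp.finsetSum_apply, Finset.sum_eq_single g]
  · simp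
  · intro h _ hh
    simp [hh]
  · simp

theorem optionProj_optionLift_mul (u : MonoidAlgebra ℚ (Perm X))
    (v : MonoidAlgebra ℚ (Perm (Option X))) :
    optionProj X (optionLift X u * v) = u * optionProj X v := by
  induction u using MonoidAlgebra.induction_linear with
  | zero => simp
  | add x y hx hy => rw [map_add, add_mul, map_add, hx, hy, add_mul]
  | single g r =>
    ext h
    rw [coeff_optionProj, optionLift_single, coeff_single_mul_apply, coeff_single_mul_apply,
      coeff_optionProj]
    congr 2
    exact (map_mul (optionCongrHom X) g⁻¹ h).symm

theorem optionProj_mul_optionLift (u : MonoidAlgebra ℚ (Perm X))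
    (v : MonoidAlgebra ℚ (Perm (Option X))) :
    optionProj X (v * optionLift X u) = optionProj X v * u := by
  induction u using MonoidAlgebra.induction_linear with
  | zero => simp
  | add x y hx hy => rw [map_add, mul_add, map_add, hx, hy, mul_add]
  | single g r =>
    ext h
    rw [coeff_optionProj, optionLift_single, coeff_mul_single_apply, coeff_mul_single_apply,
      coeff_optionProj]
    congr 2
    exact (map_mul (optionCongrHom X) h g⁻¹).symm

theorem optionProj_single_of_ne {g : Perm (Option X)} (hg : g none ≠ none) (a : ℚ) :
    optionProj X (single g a) = 0 := by
  ext h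
  rw [coeff_optionProj, coeff_single, Finsupp.single_apply, if_neg]
  · rfl
  · rintro rfl
    exact hg rfl

theorem optionProj_single_optionCongr (g : Perm X) (a : ℚ) :
    optionProj X (single (optionCongr g : Perm (Option X)) a) = single g a := by
  have := optionProj_optionLift_mul (single g a) 1
  rw [mul_one, optionLift_single] at this
  rw [this]
  have h1 : optionProj X 1 = 1 := by
    ext h
    rw [coeff_optionProj, MonoidAlgebra.one_def, MonoidAlgebra.one_def, coeff_single, coeff_single,
      Finsupp.single_apply, Finsupp.single_apply]
    congr 1
    rw [← optionCongr_one, optionCongr_injective.eq_iff]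
  rw [h1, mul_one]

omit [Fintype X] in
theorem swap_none_mul_optionCongr_removeNone (g : Perm (Option X)) :
    swap none (g none) * optionCongr (removeNone g) = g :=
  Perm.decomposeOption.left_inv g

omit [Fintype X] in
theorem removeNone_swap_mul (a : Option X) (g : Perm X) :
    removeNone (swap none a * optionCongr g) = g :=
  congrArg Prod.snd (Perm.decomposeOption.right_inv (a, g))

/-- The Jucys-Murphy element: the sum of the transpositions moving `none`. -/
noncomputable def jucysMurphy (X : Type*) [Fintype X] [DecidableEq X] :
    MonoidAlgebra ℚ (Perm (Option X)) :=
  ∑ i : X, single (swap none (some i)) 1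

theorem jucysMurphy_mul_optionLift (u : MonoidAlgebra ℚ (Perm X)) :
    jucysMurphy X * optionLift X u = optionLift X u * jucysMurphy X := by
  induction u using MonoidAlgebra.induction_linear with
  | zero => simp
  | add x y hx hy => rw [map_add, mul_add, add_mul, hx, hy]
  | single g r =>
    rw [jucysMurphy, Finset.sum_mul, Finset.mul_sum]
    symm
    refine Fintype.sum_equiv g _ _ fun i => ?_
    rw [optionLift_single, single_mul_single, single_mul_single, mul_comm r 1,
      mul_swap_eq_swap_mul]
    rfl

theorem optionProj_jucysMurphy_mul_single (g : Perm (Option X)) :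
    optionProj X (jucysMurphy X * single g 1) =
      if g none = none then 0 else single (removeNone g) 1 := by
  rw [jucysMurphy, Finset.sum_mul, map_sum]
  simp only [single_mul_single, one_mul]
  split_ifs with hg
  · refine Finset.sum_eq_zero fun i _ => optionProj_single_of_ne ?_ _
    simp [hg]
  · obtain ⟨i, hi⟩ := Option.ne_none_iff_exists'.mp hg
    rw [Finset.sum_eq_single i]
    · have h := swap_none_mul_optionCongr_removeNone g
      rw [hi] at h
      conv_lhs => rw [← h]
      rw [← mul_assoc, swap_mul_self, one_mul, optionProj_single_optionCongr]
    · intro j _ hj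
      refine optionProj_single_of_ne ?_ _
      rw [Perm.mul_apply, hi, swap_apply_of_ne_of_ne] <;> simp [hj.symm]
    · simp

theorem jucysMurphy_option :
    jucysMurphy (Option X) = single (swap none (some none)) 1 * optionLift _ (jucysMurphy X) *
      single (swap none (some none)) 1 + single (swap none (some none)) 1 := by
  rw [jucysMurphy, Fintype.sum_option, add_comm, jucysMurphy, map_sum, Finset.mul_sum,
    Finset.sum_mul]
  congr 1
  refine Finset.sum_congr rfl fun i _ => ?_
  rw [optionLift_single, single_mul_single, single_mul_single, one_mul, one_mul]
  congr 1
  have h : (optionCongr (swap none (some i)) : Perm (Option (Option X))) =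
      swap (some none) (some (some i)) := optionCongr_swap _ _
  rw [h, swap_comm none (some none), swap_comm (some none) (some (some i))]
  refine (swap_mul_swap_mul_swap ?_ ?_).symm <;> simp

theorem optionProj_swap_conj (v : MonoidAlgebra ℚ (Perm (Option X))) :
    optionProj (Option X) (single (swap none (some none)) 1 * optionLift _ v *
      single (swap none (some none)) 1) = optionLift X (optionProj X v) := by
  induction v using MonoidAlgebra.induction_linear with
  | zero => simp
  | add x y hx hy => rw [map_add, mul_add, add_mul, map_add, hx, hy, map_add, map_add]
  | single g r =>
    rw [optionLift_single, single_mul_single, single_mul_single, one_mul, mul_one]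
    by_cases hg : g none = none
    · obtain ⟨h, rfl⟩ : ∃ h : Perm X, g = optionCongr h := by
        refine ⟨removeNone g, ?_⟩
        conv_lhs => rw [← swap_none_mul_optionCongr_removeNone g, hg, swap_self]
        rfl
      rw [optionProj_single_optionCongr, optionLift_single, 
        ← optionProj_single_optionCongr (optionCongr h : Perm (Option X))]
      congr 2
      refine Equiv.ext fun x => ?_
      rcases x with _ | _ | x <;> simp [swap_apply_of_ne_of_ne]
    · rw [optionProj_single_of_ne hg, map_zero, optionProj_single_of_ne]
      obtain ⟨i, hi⟩ := Option.ne_none_iff_exists'.mp hg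
      simp [hi, swap_apply_of_ne_of_ne]

theorem pow_recurrence {R : Type*} [Ring R] {t x y : R} (ht : t * t = 1)
    (hy : y = t * x * t + t) (hxy : x * y = y * x) (k : ℕ) :
    y ^ (k + 2) - 2 * (x * y ^ (k + 1)) + (x * (x * y ^ k) - y ^ k) =
      t * x ^ (k + 2) * t - 2 * (x * (t * x ^ (k + 1) * t)) + x * (x * (t * x ^ k * t)) +
        t * x ^ (k + 1) - x * (t * x ^ k) := by
  have ht' : ∀ z, t * (t * z) = z := fun z => by rw [← mul_assoc, ht, one_mul]
  induction k with
  | zero =>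
    simp only [hy, pow_succ, pow_zero, one_mul, mul_one, mul_add, add_mul, mul_assoc, ht, ht']
    noncomm_ring
  | succ k ih =>
    have h1 : ∀ z, y * (x * z) = x * (y * z) := fun z => by
      rw [← mul_assoc, ← hxy, mul_assoc]
    have h2 : ∀ j z, y * (t * (x ^ j * z)) = t * (x ^ (j + 1) * z) + x ^ j * z := fun j z => by
      rw [hy, add_mul, ht', pow_succ']
      simp only [mul_assoc, ht']
    have h3 := congrArg (y * ·) ih
    have h4 : ∀ z, y * (2 * z) = 2 * (y * z) := fun z => by simp only [two_mul, mul_add]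
    have h5 : ∀ j, y * (t * x ^ j) = t * x ^ (j + 1) + x ^ j := fun j => by
      simpa using h2 j 1
    simp only [mul_add, mul_sub, h4, h1, h2, h5, mul_assoc, ← pow_succ'] at h3 ⊢
    rw [show k + 2 + 1 = k + 1 + 2 by ring] at h3
    rw [h3]
    rw [show x ^ (k + 2) = x * x ^ (k + 1) from pow_succ' ..,
      show x ^ (k + 1) = x * x ^ k from pow_succ' ..]
    simp only [mul_assoc]
    noncomm_ring

/-- The moments of the Jucys-Murphy element. -/
noncomputable def momentElt (X : Type*) [Fintype X] [DecidableEq X] (k : ℕ) :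
    MonoidAlgebra ℚ (Perm X) :=
  optionProj X (jucysMurphy X ^ k)

theorem momentElt_option (k : ℕ) :
    momentElt (Option X) (k + 2) - 2 * (jucysMurphy X * momentElt (Option X) (k + 1)) +
      (jucysMurphy X * (jucysMurphy X * momentElt (Option X) k) - momentElt (Option X) k) =
    optionLift X (momentElt X (k + 2)) -
      2 * (jucysMurphy X * optionLift X (momentElt X (k + 1))) +
      jucysMurphy X * (jucysMurphy X * optionLift X (momentElt X k)) := by
  have ht : (single (swap none (some none)) 1 : MonoidAlgebra ℚ (Perm (Option (Option X)))) *
      single (swap none (some none)) 1 = 1 := by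
    rw [single_mul_single, swap_mul_self, one_mul, MonoidAlgebra.one_def]
  have h := congrArg (optionProj (Option X)) (pow_recurrence ht jucysMurphy_option
    (jucysMurphy_mul_optionLift (X := Option X) (jucysMurphy X)).symm k)
  have h0 : optionProj (Option X) (single (swap none (some none)) 1) = 0 :=
    optionProj_single_of_ne (by simp) 1
  simp only [two_mul, map_add, map_sub, optionProj_optionLift_mul, ← map_pow,
    optionProj_swap_conj, optionProj_mul_optionLift, h0, zero_mul, mul_zero, add_zero,
    sub_zero] at h
  simpa only [two_mul, momentElt] using h

end JucysMurphy

section Words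

open Equiv MonoidAlgebra

/-- The product of the transpositions exchanging `none` with the letters of a word. -/
def wordPerm {X : Type*} [DecidableEq X] : (m : ℕ) → (Fin m → X) → Perm (Option X)
  | 0, _ => 1
  | m + 1, v => wordPerm m (fun i => v i.succ) * swap none (some (v 0))

theorem jucysMurphy_pow {X : Type*} [Fintype X] [DecidableEq X] (m : ℕ) :
    jucysMurphy X ^ m = ∑ v : Fin m → X, single (wordPerm m v) (1 : ℚ) := by
  induction m with
  | zero => simp [wordPerm, MonoidAlgebra.one_def]
  | succ m ih =>
    rw [pow_succ, ih, jucysMurphy, Finset.sum_mul_sum, Finset.sum_comm,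
      ← (Fin.consEquiv fun _ : Fin (m + 1) => X).sum_comp, Fintype.sum_prod_type]
    refine Finset.sum_congr rfl fun i _ => Finset.sum_congr rfl fun v _ => ?_
    rw [single_mul_single, one_mul]
    rfl

theorem wordPerm_comp {X Y : Type*} [DecidableEq X] [DecidableEq Y] (h : X ↪ Y) (m : ℕ)
    (v : Fin m → X) :
    wordPerm m (fun i => h (v i)) = (wordPerm m v).viaEmbedding h.optionMap := by
  induction m with
  | zero => exact (viaEmbedding_one _).symm
  | succ m ih =>
    rw [wordPerm, wordPerm, ih, viaEmbedding_mul, viaEmbedding_swap]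
    rfl

theorem removeNone_viaEmbedding {X Y : Type*} (g : Perm (Option X)) (h : X ↪ Y) :
    removeNone (g.viaEmbedding h.optionMap : Perm (Option Y)) =
      Perm.viaEmbedding (removeNone g) h := by
  classical
  conv_lhs => rw [← swap_none_mul_optionCongr_removeNone g]
  rw [viaEmbedding_mul, viaEmbedding_swap, viaEmbedding_optionCongr]
  exact removeNone_swap_mul _ _

theorem viaEmbedding_optionMap_none {X Y : Type*} (g : Perm (Option X)) (h : X ↪ Y) :
    (g.viaEmbedding h.optionMap : Perm (Option Y)) none = none ↔ g none = none := by
  have h1 := Perm.viaEmbedding_apply g h.optionMap none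
  have h2 : h.optionMap none = none := rfl
  rw [h2] at h1
  rw [h1]
  cases g none <;> simp

open Classical in
theorem momentElt_succ {X : Type*} [Fintype X] [DecidableEq X] (m : ℕ) :
    momentElt X (m + 1) = ∑ r : Setoid (Fin m),
      if wordPerm m (Quotient.mk r) none = none then 0
      else embSum X (removeNone (wordPerm m (Quotient.mk r)) : Perm (Quotient r)) := by
  rw [momentElt, pow_succ', jucysMurphy_pow, Finset.mul_sum, map_sum]
  simp only [optionProj_jucysMurphy_mul_single]
  rw [sum_fun_eq_sum_setoid]
  refine Finset.sum_congr rfl fun r _ => ?_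
  simp only [wordPerm_comp _ m (Quotient.mk r), viaEmbedding_optionMap_none,
    removeNone_viaEmbedding]
  split_ifs
  · simp
  · rw [embSum_eq_sum]

theorem momentElt_zero (X : Type*) [Fintype X] [DecidableEq X] : momentElt X 0 = 1 := by
  rw [momentElt, pow_zero, MonoidAlgebra.one_def, MonoidAlgebra.one_def, ← optionCongr_one,
    optionProj_single_optionCongr]

theorem momentElt_one (X : Type*) [Fintype X] [DecidableEq X] : momentElt X 1 = 0 := by
  rw [momentElt_succ]
  exact Finset.sum_eq_zero fun r _ => if_pos rfl

theorem momentElt_central {X : Type*} [Fintype X] [DecidableEq X] (k : ℕ)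
    (x : MonoidAlgebra ℚ (Perm X)) : momentElt X k * x = x * momentElt X k := by
  rw [momentElt, ← optionProj_mul_optionLift, ← optionProj_optionLift_mul]
  congr 1
  exact (Commute.pow_left (jucysMurphy_mul_optionLift x) k).eq

theorem wordPerm_apply_of_notMem {X : Type*} [DecidableEq X] (m : ℕ) (v : Fin m → X) (x : X)
    (hx : ∀ i, v i ≠ x) : wordPerm m v (some x) = some x := by
  induction m with
  | zero => rfl
  | succ m ih =>
    rw [wordPerm, Perm.mul_apply, swap_apply_of_ne_of_ne (by simp) (by simp [(hx 0).symm]),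
      ih _ fun i => hx i.succ]

theorem wordPerm_apply_of_injective {X : Type*} [DecidableEq X] (m : ℕ) (v : Fin m → X)
    (hv : Function.Injective v) :
    (wordPerm m v none = if h : 0 < m then some (v ⟨0, h⟩) else none) ∧
    ∀ j : Fin m, wordPerm m v (some (v j)) =
      if h : (j : ℕ) + 1 < m then some (v ⟨j + 1, h⟩) else none := by
  induction m with
  | zero => exact ⟨rfl, fun j => j.elim0⟩
  | succ m ih =>
    obtain ⟨ih0, ih1⟩ := ih (fun i => v i.succ) (hv.comp (Fin.succ_injective m))
    refine ⟨?_, fun j => ?_⟩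
    · rw [wordPerm, Perm.mul_apply, swap_apply_left, wordPerm_apply_of_notMem]
      · simp
      · exact fun i h => Fin.succ_ne_zero i (hv h)
    · rw [wordPerm, Perm.mul_apply]
      induction j using Fin.cases with
      | zero =>
        rw [swap_apply_right, ih0]
        simp
      | succ j =>
        rw [swap_apply_of_ne_of_ne (by simp) (by simp [hv.eq_iff]), ih1]
        simp

theorem wordPerm_id (m : ℕ) :
    wordPerm (m + 1) (id : Fin (m + 1) → Fin (m + 1)) none ≠ none ∧
      removeNone (wordPerm (m + 1) id : Perm (Option (Fin (m + 1)))) = finRotate (m + 1) := by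
  obtain ⟨h0, h1⟩ := wordPerm_apply_of_injective (m + 1) (id : Fin (m + 1) → Fin (m + 1))
    Function.injective_id
  refine ⟨by simp [h0], Equiv.ext fun j => Option.some_injective _ ?_⟩
  induction j using Fin.lastCases with
  | last =>
    rw [removeNone_none _ (by simpa using h1 (Fin.last m)), h0, finRotate_last]
    rfl
  | cast j =>
    have h := h1 j.castSucc
    simp only [id_eq, Fin.val_castSucc, add_lt_add_iff_right, j.isLt, dite_true] at h
    rw [removeNone_some _ ⟨_, h⟩, h, finRotate_apply]
    congr 1
    ext
    simp
end Words

section Moments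

open Equiv MonoidAlgebra

variable {X : Type*} [Fintype X] [DecidableEq X]

/-- The scalar by which the `k`-th moment acts on a Young symmetrizer. -/
noncomputable def fillingMoment (row col : X → ℕ) (k : ℕ) : ℚ :=
  (momentElt X k * symmetrizer row col).coeff 1

theorem IsFilling.momentElt_mul_symmetrizer {μ : YoungDiagram} {row col : X → ℕ}
    (h : IsFilling μ row col) (k : ℕ) :
    momentElt X k * symmetrizer row col = fillingMoment row col k • symmetrizer row col :=
  h.central_mul_symmetrizer (momentElt_central k)

/-- The moments of the transition measure of a Young diagram. -/
noncomputable def moment (k : ℕ) (μ : YoungDiagram) : ℚ :=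
  fillingMoment (rowOf μ) (colOf μ) k

open Classical in
theorem fillingMoment_succ (row col : X → ℕ) (m : ℕ) :
    fillingMoment row col (m + 1) = ∑ r : Setoid (Fin m),
      if wordPerm m (Quotient.mk r) none = none then 0
      else fillingChar row col (removeNone (wordPerm m (Quotient.mk r)) : Perm (Quotient r)) := by
  unfold fillingMoment
  rw [momentElt_succ, Finset.sum_mul, coeff_sum, Finsupp.finsetSum_apply]
  refine Finset.sum_congr rfl fun r _ => ?_
  split_ifs
  · simp
  · rfl

theorem IsFilling.fillingMoment_zero {μ : YoungDiagram} {row col : X → ℕ}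
    (h : IsFilling μ row col) : fillingMoment row col 0 = 1 := by
  rw [fillingMoment, momentElt_zero, one_mul, h.coeff_symmetrizer_one]

theorem IsFilling.fillingMoment_eq_moment {μ : YoungDiagram} {row col : X → ℕ}
    (h : IsFilling μ row col) (k : ℕ) : fillingMoment row col k = moment k μ := by
  cases k with
  | zero => rw [moment, h.fillingMoment_zero, (isFilling_fill μ).fillingMoment_zero]
  | succ k =>
    rw [moment, fillingMoment_succ, fillingMoment_succ]
    refine Finset.sum_congr rfl fun r _ => ?_
    rw [h.fillingChar_eq (isFilling_fill μ)]

theorem moment_zero : moment 0 = 1 :=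
  funext fun μ => (isFilling_fill μ).fillingMoment_zero

theorem moment_one : moment 1 = 0 := by
  funext μ
  rw [moment, fillingMoment, momentElt_one]
  simp

open Classical in
theorem moment_add_two (m : ℕ) :
    moment (m + 2) = sigma (finRotate (m + 1)) + ∑ r : Setoid (Fin (m + 1)) with r ≠ ⊥,
      if wordPerm (m + 1) (Quotient.mk r) none = none then 0
      else sigma (removeNone (wordPerm (m + 1) (Quotient.mk r)) : Perm (Quotient r)) := by
  funext μ
  rw [moment, fillingMoment_succ, Pi.add_apply, Finset.sum_apply, Finset.filter_ne',
    add_comm (sigma _ _), ← Finset.sum_erase_add _ _ (Finset.mem_univ (⊥ : Setoid (Fin (m + 1))))]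
  congr 1
  · refine Finset.sum_congr rfl fun r _ => ?_
    split_ifs
    · rfl
    · rfl
  · let e : Fin (m + 1) ≃ Quotient (⊥ : Setoid (Fin (m + 1))) :=
      Equiv.ofBijective (Quotient.mk _) ⟨fun a b h => Quotient.exact h, Quotient.mk_surjective⟩
    have he : wordPerm (m + 1) (Quotient.mk (⊥ : Setoid (Fin (m + 1)))) =
        (wordPerm (m + 1) id).viaEmbedding e.toEmbedding.optionMap :=
      wordPerm_comp e.toEmbedding (m + 1) id
    rw [he, if_neg ((viaEmbedding_optionMap_none _ _).not.mpr (wordPerm_id m).1),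
      removeNone_viaEmbedding,
      (wordPerm_id m).2, ← sigma_permCongr e]
    change _ = fillingChar _ _ _
    congr 1
    have := viaEmbedding_trans_equiv (finRotate (m + 1)) (Function.Embedding.refl _) e
    refine this.trans ?_
    congr 1
    ext x
    exact congrArg _ (Perm.viaEmbedding_apply _ (Function.Embedding.refl _) x)

end Moments

section Corner

open Equiv MonoidAlgebra

theorem IsFilling.transpose {μ : YoungDiagram} {X : Type*} {row col : X → ℕ}
    (h : IsFilling μ row col) : IsFilling μ.transpose col row where
  inj x y h₁ h₂ := h.inj x y h₂ h₁
  mem x := by simpa [YoungDiagram.mem_transpose] using h.mem x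
  surj c hc := by
    obtain ⟨x, hx⟩ := h.surj c.swap (by simpa [YoungDiagram.mem_transpose] using hc)
    exact ⟨x, hx.2, hx.1⟩

variable {X : Type*} [Fintype X] [DecidableEq X]

/-- The sum of the transpositions, in which each of them appears twice, plus the number of points
times the identity. -/
noncomputable def swapSum (X : Type*) [Fintype X] [DecidableEq X] : MonoidAlgebra ℚ (Perm X) :=
  ∑ i : X, ∑ j : X, single (swap i j) 1

theorem swapSum_central (x : MonoidAlgebra ℚ (Perm X)) : swapSum X * x = x * swapSum X := by
  induction x using MonoidAlgebra.induction_linear with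
  | zero => simp
  | add x y hx hy => rw [mul_add, add_mul, hx, hy]
  | single g r =>
    simp only [swapSum, Finset.sum_mul, Finset.mul_sum, single_mul_single]
    symm
    refine Fintype.sum_equiv g _ _ fun i => Fintype.sum_equiv g _ _ fun j => ?_
    rw [mul_comm r 1, mul_swap_eq_swap_mul]

theorem swapSum_option :
    swapSum (Option X) = optionLift X (swapSum X) + (2 : ℚ) • jucysMurphy X + 1 := by
  simp only [swapSum, Fintype.sum_option, Finset.sum_add_distrib, map_sum, optionLift_single,
    two_smul, jucysMurphy, swap_self, optionCongr_swap]
  simp only [swap_comm (some _) none, MonoidAlgebra.one_def]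
  change single 1 1 + _ + (_ + _) = _
  abel

theorem IsFilling.coeff_symmetrizer_optionCongr {μ : YoungDiagram} {row col : Option X → ℕ}
    (h : IsFilling μ row col) (g : Perm X) :
    (symmetrizer row col).coeff (optionCongr g) =
      (symmetrizer (row ∘ some) (col ∘ some)).coeff g := by
  rw [coeff_symmetrizer, coeff_symmetrizer]
  symm
  refine Fintype.sum_of_injective (optionCongr : Perm X → Perm (Option X))
    optionCongr_injective _ _ (fun q hq => if_neg ?_) fun q => ?_
  · rintro ⟨h1, h2⟩
    have h3 : q none = none := h.fixed_of_fixed h1 h2 rfl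
    refine hq ⟨removeNone q, ?_⟩
    conv_rhs => rw [← swap_none_mul_optionCongr_removeNone q, h3, swap_self]
    rfl
  · have h3 : (optionCongr g * (optionCongr q)⁻¹ : Perm (Option X)) = optionCongr (g * q⁻¹) :=
      (map_mul (optionCongrHom X) g q⁻¹).symm
    refine if_congr ?_ (by rw [optionCongr_sign]) rfl
    simp [h3, Option.forall]

omit [DecidableEq X] in
theorem IsFilling.card_row {μ : YoungDiagram} {row col : Option X → ℕ}
    (h : IsFilling μ row col) (hμ : (row none, col none + 1) ∉ μ) :
    ∑ i : X, (if row none = row (some i) then 1 else 0 : ℚ) = col none := by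
  rw [Finset.sum_boole]
  congr 1
  conv_rhs => rw [← Finset.card_range (col none)]
  refine Finset.card_nbij (fun i => col (some i)) ?_ ?_ ?_
  · intro i hi
    have hi' : row none = row (some i) := by simpa using hi
    simp only [Finset.coe_range, Set.mem_Iio]
    by_contra hlt
    have hne : col none ≠ col (some i) := fun he => by simpa using h.inj _ _ hi' he
    have hm := h.mem (some i)
    rw [← hi'] at hm
    exact hμ (μ.isLowerSet (Prod.mk_le_mk.mpr ⟨le_rfl, by omega⟩) hm)
  · intro i hi j hj hij
    have hi' : row none = row (some i) := by simpa using hi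
    have hj' : row none = row (some j) := by simpa using hj
    exact Option.some_injective _ (h.inj _ _ (hi'.symm.trans hj') hij)
  · intro c hc
    have hc' : c < col none := by simpa using hc
    obtain ⟨x, h1, h2⟩ := h.surj (row none, c)
      (μ.isLowerSet (Prod.mk_le_mk.mpr ⟨le_rfl, hc'.le⟩) (h.mem none))
    cases x with
    | none => exact absurd h2 hc'.ne'
    | some i => exact ⟨i, by simpa using h1.symm, h2⟩

theorem coeff_mul_swapSum_one (x : MonoidAlgebra ℚ (Perm X)) :
    (swapSum X * x).coeff 1 = ∑ i : X, ∑ j : X, x.coeff (swap i j) := by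
  simp only [swapSum, Finset.sum_mul, coeff_sum, Finsupp.finsetSum_apply, coeff_single_mul_apply,
    one_mul, mul_one, swap_inv]

theorem IsFilling.jucysMurphy_mul {μ ν : YoungDiagram} {row col : Option X → ℕ}
    (h : IsFilling μ row col) (h' : IsFilling ν (row ∘ some) (col ∘ some))
    (h₁ : (row none, col none + 1) ∉ μ) (h₂ : (row none + 1, col none) ∉ μ) :
    jucysMurphy X * (optionLift X (symmetrizer (row ∘ some) (col ∘ some)) *
      symmetrizer row col) = ((col none : ℚ) - row none) •
        (optionLift X (symmetrizer (row ∘ some) (col ∘ some)) * symmetrizer row col) := by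
  have e1 := h.central_mul_symmetrizer (swapSum_central (X := Option X))
  have e2 := h'.central_mul_symmetrizer (swapSum_central (X := X))
  have hcol := h.transpose.card_row (by simpa [YoungDiagram.mem_transpose] using h₂)
  have hc : (swapSum (Option X) * symmetrizer row col).coeff 1 =
      (swapSum X * symmetrizer (row ∘ some) (col ∘ some)).coeff 1 +
        2 * ((col none : ℚ) - row none) + 1 := by
    have hJ : ∑ i : X, (symmetrizer row col).coeff (swap none (some i)) =
        (col none : ℚ) - row none := by
      rw [← h.card_row h₁, ← hcol, ← Finset.sum_sub_distrib]
      exact Finset.sum_congr rfl fun i _ => h.coeff_symmetrizer_swap (by simp)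
    rw [coeff_mul_swapSum_one, coeff_mul_swapSum_one]
    simp only [Fintype.sum_option, Finset.sum_add_distrib, swap_comm (some _) none, hJ, swap_self,
      ← h.coeff_symmetrizer_optionCongr, optionCongr_swap]
    have h1 : (symmetrizer row col).coeff (Equiv.refl _) = 1 := h.coeff_symmetrizer_one
    rw [h1]
    ring
  rw [hc] at e1
  generalize (swapSum X * symmetrizer (row ∘ some) (col ∘ some)).coeff 1 = τ at e1 e2
  generalize symmetrizer (row ∘ some) (col ∘ some) = d at *
  generalize symmetrizer row col = c at *
  have e3 : swapSum (Option X) * (optionLift X d * c) =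
      (τ + 2 * ((col none : ℚ) - row none) + 1) • (optionLift X d * c) := by
    rw [← mul_assoc, swapSum_central, mul_assoc, e1, mul_smul_comm]
  rw [swapSum_option, add_mul, add_mul, ← mul_assoc (optionLift X _), ← map_mul, e2, map_smul,
    smul_mul_assoc, smul_mul_assoc, one_mul, add_smul, add_smul, one_smul] at e3
  have e4 := add_left_cancel (add_right_cancel e3)
  rw [mul_smul] at e4
  exact smul_right_injective _ (two_ne_zero (α := ℚ)) e4

theorem IsFilling.fillingMoment_option {μ ν : YoungDiagram} {row col : Option X → ℕ}
    (h : IsFilling μ row col) (h' : IsFilling ν (row ∘ some) (col ∘ some))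
    (h₁ : (row none, col none + 1) ∉ μ) (h₂ : (row none + 1, col none) ∉ μ) (k : ℕ) :
    moment (k + 2) μ - 2 * ((col none : ℚ) - row none) * moment (k + 1) μ +
        (((col none : ℚ) - row none) ^ 2 - 1) * moment k μ =
      moment (k + 2) ν - 2 * ((col none : ℚ) - row none) * moment (k + 1) ν +
        ((col none : ℚ) - row none) ^ 2 * moment k ν := by
  have hJ := h.jucysMurphy_mul h' h₁ h₂
  have hv : optionLift X (symmetrizer (row ∘ some) (col ∘ some)) * symmetrizer row col ≠ 0 := by
    intro h0
    refine h'.coeff_symmetrizer_mul_self_ne_zero ?_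
    have h3 : optionProj X (symmetrizer row col) = symmetrizer (row ∘ some) (col ∘ some) := by
      ext g
      rw [coeff_optionProj, h.coeff_symmetrizer_optionCongr]
    have h4 := optionProj_optionLift_mul (symmetrizer (row ∘ some) (col ∘ some))
      (symmetrizer row col)
    rw [h0, h3, map_zero] at h4
    rw [← h4]
    rfl
  have hM : ∀ j, momentElt (Option X) j *
      (optionLift X (symmetrizer (row ∘ some) (col ∘ some)) * symmetrizer row col) =
      moment j μ •
        (optionLift X (symmetrizer (row ∘ some) (col ∘ some)) * symmetrizer row col) := by
    intro j
    rw [← mul_assoc, momentElt_central, mul_assoc, h.momentElt_mul_symmetrizer,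
      h.fillingMoment_eq_moment, mul_smul_comm]
  have hM' : ∀ j, optionLift X (momentElt X j) *
      (optionLift X (symmetrizer (row ∘ some) (col ∘ some)) * symmetrizer row col) =
      moment j ν •
        (optionLift X (symmetrizer (row ∘ some) (col ∘ some)) * symmetrizer row col) := by
    intro j
    rw [← mul_assoc, ← map_mul, h'.momentElt_mul_symmetrizer, h'.fillingMoment_eq_moment,
      map_smul, smul_mul_assoc]
  generalize optionLift X (symmetrizer (row ∘ some) (col ∘ some)) * symmetrizer row col = v at *
  have key := congrArg (· * v) (momentElt_option (X := X) k)
  simp only [two_mul, add_mul, sub_mul, mul_assoc, hM, hM', hJ, mul_smul_comm, smul_smul,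
    ← add_smul, ← sub_smul] at key
  have := smul_left_injective ℚ hv key
  linarith

end Corner

section MomentSeries

open Equiv MonoidAlgebra

/-- The generating series of the moments. -/
noncomputable def momentSeries (μ : YoungDiagram) : PowerSeries ℚ :=
  PowerSeries.mk fun k => moment k μ

/-- The content of a cell. -/
def content (c : ℕ × ℕ) : ℚ := (c.2 : ℚ) - c.1

theorem exists_erase (μ : YoungDiagram) (hμ : μ.cells.Nonempty) :
    ∃ ν : YoungDiagram, ∃ x ∉ ν.cells, μ.cells = insert x ν.cells ∧
      ∀ k, moment (k + 2) μ - 2 * content x * moment (k + 1) μ +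
          (content x ^ 2 - 1) * moment k μ =
        moment (k + 2) ν - 2 * content x * moment (k + 1) ν + content x ^ 2 * moment k ν := by
  obtain ⟨x, hx, hmax⟩ := μ.cells.exists_maximal hμ
  let ν : YoungDiagram := ⟨μ.cells.erase x, fun a b hba ha => by
    simp only [Finset.coe_erase, Set.mem_sdiff, Finset.mem_coe, Set.mem_singleton_iff] at ha ⊢
    refine ⟨μ.isLowerSet hba ha.1, fun hb => ha.2 ?_⟩
    exact le_antisymm (hmax ha.1 (hb ▸ hba)) (hb ▸ hba)⟩
  have hν : ∀ c, c ∈ ν ↔ c ∈ μ ∧ c ≠ x := fun c => by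
    rw [← YoungDiagram.mem_cells]
    simp [ν, and_comm]
  refine ⟨ν, x, by simp [ν], by simp [ν, Finset.insert_erase hx], fun k => ?_⟩
  let row : Option {c // c ∈ ν.cells} → ℕ := fun o => o.elim x.1 fun c => c.1.1
  let col : Option {c // c ∈ ν.cells} → ℕ := fun o => o.elim x.2 fun c => c.1.2
  have h : IsFilling μ row col := by
    refine ⟨?_, ?_, ?_⟩
    · rintro (_ | a) (_ | b) h1 h2
      · rfl
      · exact absurd (Prod.ext h1 h2).symm ((hν _).mp b.2).2
      · exact absurd (Prod.ext h1 h2) ((hν _).mp a.2).2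
      · exact congrArg some (Subtype.ext (Prod.ext h1 h2))
    · rintro (_ | a)
      · exact hx
      · exact ((hν _).mp a.2).1
    · intro c hc
      by_cases hcx : c = x
      · exact ⟨none, by simp [row, hcx], by simp [col, hcx]⟩
      · exact ⟨some ⟨c, (hν c).mpr ⟨hc, hcx⟩⟩, rfl, rfl⟩
  have h' : IsFilling ν (row ∘ some) (col ∘ some) := by
    refine ⟨fun a b h1 h2 => Subtype.ext (Prod.ext h1 h2), fun a => a.2, fun c hc => ?_⟩
    exact ⟨⟨c, hc⟩, rfl, rfl⟩
  refine h.fillingMoment_option h' (fun hm => ?_) (fun hm => ?_) k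
  · have := hmax hm (Prod.mk_le_mk.mpr ⟨le_rfl, Nat.le_succ _⟩)
    exact absurd this.2 (Nat.not_succ_le_self _)
  · have := hmax hm (Prod.mk_le_mk.mpr ⟨Nat.le_succ _, le_rfl⟩)
    exact absurd this.1 (Nat.not_succ_le_self _)

open PowerSeries in
theorem momentSeries_mul_prod (μ : YoungDiagram) :
    momentSeries μ * ∏ c ∈ μ.cells, ((1 - C (content c) * X) ^ 2 - X ^ 2) =
      ∏ c ∈ μ.cells, (1 - C (content c) * X) ^ 2 := by
  induction hn : μ.cells.card generalizing μ with
  | zero =>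
    have h0 : μ.cells = ∅ := Finset.card_eq_zero.mp hn
    have : IsEmpty (Fin μ.card) := by
      rw [show μ.card = 0 from hn]
      infer_instance
    rw [h0, Finset.prod_empty, Finset.prod_empty, mul_one]
    ext k
    rw [momentSeries, coeff_mk]
    cases k with
    | zero => simp [moment_zero]
    | succ k =>
      simp [moment, fillingMoment, momentElt, jucysMurphy]
  | succ n ih =>
    obtain ⟨ν, x, hx, hcells, hrec⟩ := exists_erase μ (Finset.card_pos.mp (by omega))
    have hcard : ν.cells.card = n := by
      rw [hcells, Finset.card_insert_of_notMem hx] at hn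
      omega
    have key : momentSeries μ * ((1 - C (content x) * X) ^ 2 - X ^ 2) =
        momentSeries ν * (1 - C (content x) * X) ^ 2 := by
      have e1 : momentSeries μ * ((1 - C (content x) * X) ^ 2 - X ^ 2) =
          momentSeries μ - C (2 * content x) * (momentSeries μ * X) +
            C (content x ^ 2 - 1) * (momentSeries μ * X * X) := by
        simp only [map_mul, map_sub, map_pow, map_one, map_ofNat]
        ring
      have e2 : momentSeries ν * (1 - C (content x) * X) ^ 2 =
          momentSeries ν - C (2 * content x) * (momentSeries ν * X) +
            C (content x ^ 2) * (momentSeries ν * X * X) := by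
        simp only [map_mul, map_pow, map_ofNat]
        ring
      rw [e1, e2]
      generalize content x ^ 2 - 1 = a at hrec
      generalize content x ^ 2 = b at hrec
      ext k
      rcases k with _ | _ | k
      · simp [momentSeries, moment_zero]
      · simp only [map_add, map_sub, coeff_C_mul, coeff_succ_mul_X, coeff_zero_mul_X, momentSeries,
          coeff_mk, zero_add, moment_zero, moment_one, Pi.zero_apply, Pi.one_apply]
        ring
      · have := hrec k
        simp only [map_add, map_sub, coeff_C_mul, coeff_succ_mul_X, momentSeries, coeff_mk]
        linarith
    rw [hcells, Finset.prod_insert hx, Finset.prod_insert hx, ← mul_assoc, key,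
      ← ih ν hcard]
    ring

end MomentSeries

section Dilation

theorem mem_cells_dilate {μ : YoungDiagram} {s : ℕ} (hs : 0 < s) (c : ℕ × ℕ) :
    c ∈ (dilate μ s).cells ↔ (c.1 / s, c.2 / s) ∈ μ.cells := by
  simp only [dilate, Finset.mem_filter, Finset.mem_product, Finset.mem_range, and_iff_right_iff_imp]
  intro h
  have h1 : (c.1 / s, 0) ∈ μ := μ.isLowerSet (Prod.mk_le_mk.mpr ⟨le_rfl, Nat.zero_le _⟩) h
  have h2 : (0, c.2 / s) ∈ μ := μ.isLowerSet (Prod.mk_le_mk.mpr ⟨Nat.zero_le _, le_rfl⟩) h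
  rw [YoungDiagram.mem_iff_lt_colLen] at h1
  rw [YoungDiagram.mem_iff_lt_rowLen] at h2
  rw [Nat.div_lt_iff_lt_mul hs, mul_comm] at h1 h2
  exact ⟨h1, h2⟩

theorem prod_cells_dilate {M : Type*} [CommMonoid M] (μ : YoungDiagram) {s : ℕ} (hs : 0 < s)
    (f : ℕ × ℕ → M) :
    ∏ c ∈ (dilate μ s).cells, f c =
      ∏ c ∈ μ.cells, ∏ a ∈ Finset.range s, ∏ b ∈ Finset.range s, f (s * c.1 + a, s * c.2 + b) := by
  simp_rw [← Finset.prod_product']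
  refine Finset.prod_nbij' (fun c => ((c.1 / s, c.2 / s), (c.1 % s, c.2 % s)))
    (fun p => (s * p.1.1 + p.2.1, s * p.1.2 + p.2.2)) ?_ ?_ ?_ ?_ ?_
  · intro c hc
    rw [mem_cells_dilate hs] at hc
    simp [hc, Nat.mod_lt _ hs]
  · rintro ⟨⟨i, j⟩, a, b⟩ h
    simp only [Finset.mem_product, Finset.mem_range] at h
    rw [mem_cells_dilate hs]
    simpa [Nat.mul_add_div hs, Nat.div_eq_of_lt h.2.1, Nat.div_eq_of_lt h.2.2] using h.1
  · intro c _
    simp [Nat.div_add_mod]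
  · rintro ⟨⟨i, j⟩, a, b⟩ h
    simp only [Finset.mem_product, Finset.mem_range] at h
    simp [Nat.mul_add_div hs, Nat.div_eq_of_lt h.2.1, Nat.div_eq_of_lt h.2.2,
      Nat.mod_eq_of_lt h.2.1, Nat.mod_eq_of_lt h.2.2]
  · intro c _
    simp [Nat.div_add_mod]

theorem prod_range_prod_range_telescope {G : Type*} [CommGroup G] (f : ℚ → G) (d : ℚ) (s t : ℕ) :
    ∏ a ∈ Finset.range s, ∏ b ∈ Finset.range t,
      f (d + b - a) ^ 2 / (f (d + b - a + 1) * f (d + b - a - 1)) =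
    f d * f (d + t - s) / (f (d + t) * f (d - s)) := by
  have h1 : ∀ a : ℕ, ∏ b ∈ Finset.range t,
      f (d + b - a) ^ 2 / (f (d + b - a + 1) * f (d + b - a - 1)) =
      (f (d + t - (a + 1 : ℕ)) / f (d - (a + 1 : ℕ))) / (f (d + t - a) / f (d - a)) := by
    intro a
    have h := Finset.prod_range_div (fun b : ℕ => f (d + b - a - 1) / f (d + b - a)) t
    have e1 : d + t - a - 1 = d + t - (a + 1 : ℕ) := by push_cast; ring
    have e2 : d - a - 1 = d - (a + 1 : ℕ) := by push_cast; ring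
    simp only [e1, Nat.cast_zero, add_zero, e2] at h
    rw [div_div_div_comm, ← h]
    refine Finset.prod_congr rfl fun b _ => ?_
    have e3 : d + (b + 1 : ℕ) - a - 1 = d + b - a := by push_cast; ring
    have e4 : d + (b + 1 : ℕ) - a = d + b - a + 1 := by push_cast; ring
    rw [e3, e4, div_div_div_eq, sq]
  rw [Finset.prod_congr rfl fun a _ => h1 a,
    Finset.prod_range_div fun a : ℕ => f (d + t - a) / f (d - a)]
  simp only [Nat.cast_zero, sub_zero]
  rw [div_div_div_eq, mul_comm (f d), mul_comm (f (d - s))]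

open PowerSeries

/-- The power series `1 - d X`. -/
noncomputable def linearUnit (d : ℚ) : (PowerSeries ℚ)ˣ :=
  IsUnit.unit (a := 1 - C d * X) (by simp [PowerSeries.isUnit_iff_constantCoeff])

theorem momentSeries_eq (μ : YoungDiagram) :
    momentSeries μ = ((∏ c ∈ μ.cells, linearUnit (content c) ^ 2 /
      (linearUnit (content c + 1) * linearUnit (content c - 1)) : (PowerSeries ℚ)ˣ) :
        PowerSeries ℚ) := by
  have hu : ∀ d, (linearUnit d : PowerSeries ℚ) = 1 - C d * X := fun d => IsUnit.unit_spec _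
  have h := momentSeries_mul_prod μ
  have h1 : ∏ c ∈ μ.cells, ((1 - C (content c) * X) ^ 2 - X ^ 2) =
      ((∏ c ∈ μ.cells, linearUnit (content c + 1) * linearUnit (content c - 1) :
        (PowerSeries ℚ)ˣ) : PowerSeries ℚ) := by
    rw [Units.coe_prod]
    refine Finset.prod_congr rfl fun c _ => ?_
    rw [Units.val_mul, hu, hu, map_add, map_sub, map_one]
    ring
  have h2 : ∏ c ∈ μ.cells, (1 - C (content c) * X) ^ 2 =
      ((∏ c ∈ μ.cells, linearUnit (content c) ^ 2 : (PowerSeries ℚ)ˣ) : PowerSeries ℚ) := by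
    rw [Units.coe_prod]
    refine Finset.prod_congr rfl fun c _ => ?_
    rw [Units.val_pow_eq_pow_val, hu]
  rw [h1, h2] at h
  rw [Finset.prod_div_distrib, div_eq_mul_inv, Units.val_mul,
    Units.eq_mul_inv_iff_mul_eq, h]

theorem momentSeries_dilate (μ : YoungDiagram) {s : ℕ} (hs : 0 < s) :
    momentSeries (dilate μ s) = rescale (s : ℚ) (momentSeries μ) := by
  have hr : ∀ d, Units.map (rescale (s : ℚ)).toMonoidHom (linearUnit d) =
      linearUnit (s * d) := by
    intro d
    ext1
    change rescale (s : ℚ) (1 - C d * X) = 1 - C (s * d) * X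
    ext n
    simp only [coeff_rescale, map_sub, coeff_C_mul, coeff_one, coeff_X]
    rcases n with _ | _ | n <;> simp
  have h1 : rescale (s : ℚ) (momentSeries μ) =
      ((Units.map (rescale (s : ℚ)).toMonoidHom) (∏ c ∈ μ.cells, linearUnit (content c) ^ 2 /
        (linearUnit (content c + 1) * linearUnit (content c - 1)))).val := by
    rw [momentSeries_eq]
    rfl
  rw [h1, momentSeries_eq, prod_cells_dilate μ hs, map_prod]
  congr 1
  refine Finset.prod_congr rfl fun c _ => ?_
  rw [map_div, map_mul, map_pow, hr, hr, hr]
  have := prod_range_prod_range_telescope linearUnit (s * content c) s s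
  have e1 : (s : ℚ) * content c + s - s = s * content c := by ring
  rw [e1] at this
  rw [mul_add, mul_sub, mul_one, sq, ← this]
  refine Finset.prod_congr rfl fun a _ => Finset.prod_congr rfl fun b _ => ?_
  have e2 : content (s * c.1 + a, s * c.2 + b) = s * content c + b - a := by
    simp only [content]
    push_cast
    ring
  rw [e2]

theorem moment_dilate (μ : YoungDiagram) {s : ℕ} (hs : 0 < s) (k : ℕ) :
    moment k (dilate μ s) = (s : ℚ) ^ k * moment k μ := by
  have := congrArg (coeff k) (momentSeries_dilate μ hs)
  rwa [coeff_rescale, momentSeries, momentSeries, coeff_mk, coeff_mk] at this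

end Dilation

section Kerov

open Equiv

/-- The algebra of polynomials with integer coefficients in the moments `M_2, …, M_m`. -/
noncomputable def momentAlgebra (m : ℕ) : Subalgebra ℤ (YoungDiagram → ℚ) :=
  Algebra.adjoin ℤ {f | ∃ j, 2 ≤ j ∧ j ≤ m ∧ moment j = f}

theorem momentAlgebra_mono : Monotone momentAlgebra := fun _ _ h =>
  Algebra.adjoin_mono fun _ ⟨j, h2, hj, hf⟩ => ⟨j, h2, hj.trans h, hf⟩

theorem moment_mem_momentAlgebra {j : ℕ} (hj : 2 ≤ j) : moment j ∈ momentAlgebra j :=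
  Algebra.subset_adjoin ⟨j, hj, le_rfl, rfl⟩

theorem exists_permCongr_finRotate {ι : Type*} [Finite ι] {n : ℕ} (hn : Nat.card ι = n + 1)
    (π : Perm ι) (x : ι) (hx : ∀ y, π.SameCycle x y) :
    ∃ e : Fin (n + 1) ≃ ι, π = e.permCongr (finRotate (n + 1)) := by
  have := Fintype.ofFinite ι
  obtain ⟨e⟩ : Nonempty (Fin (n + 1) ≃ ι) :=
    ⟨(Finite.equivFinOfCardEq hn).symm⟩
  obtain ⟨σ, rfl⟩ := e.permCongr.surjective π
  obtain ⟨x, rfl⟩ := e.surjective x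
  suffices h : IsConj (finRotate (n + 1)) σ by
    obtain ⟨c, rfl⟩ := isConj_iff.mp h
    exact ⟨c.trans e, rfl⟩
  have hσ : ∀ y, σ.SameCycle x y := fun y => by
    obtain ⟨i, hi⟩ := hx (e y)
    refine ⟨i, e.injective ?_⟩
    rw [← hi]
    have : (e.permCongr σ) ^ i = e.permCongr (σ ^ i) := (map_zpow e.permCongrHom σ i).symm
    simp [this]
  cases n with
  | zero =>
    have h : finRotate (0 + 1) = σ := Equiv.ext fun i => Subsingleton.elim (α := Fin 1) _ _
    exact h ▸ IsConj.refl _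
  | succ n =>
    have hne : ∀ y, σ y ≠ y := by
      intro y hy
      obtain ⟨z, hz⟩ := exists_ne x
      have hxx := ((hσ y).apply_eq_self_iff).mpr hy
      exact hz ((hσ z).eq_of_left hxx).symm
    refine isCycle_finRotate.isConj ⟨x, hne x, fun y _ => hσ y⟩ ?_
    rw [support_finRotate]
    congr 1
    ext y
    simp [hne]

theorem permCongr_sumCompl {ι : Type*} (π : Perm ι) (p : ι → Prop) [DecidablePred p]
    (h₁ : ∀ x, p (π x) ↔ p x) (h₂ : ∀ x, ¬ p (π x) ↔ ¬ p x) :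
    (Equiv.sumCompl p).permCongr (Perm.sumCongr (π.subtypePerm h₁) (π.subtypePerm h₂)) = π := by
  ext x
  obtain ⟨y, rfl⟩ := (Equiv.sumCompl p).surjective x
  cases y <;> simp

theorem sigma_of_isEmpty {ι : Type*} [IsEmpty ι] (π : Perm ι) : sigma π = 1 := by
  funext μ
  have := Fintype.ofFinite (ι ↪ Fin μ.card)
  have : Unique (ι ↪ Fin μ.card) :=
    { default := Function.Embedding.ofIsEmpty, uniq := fun f => by ext x; exact isEmptyElim x }
  rw [sigma, fillingChar_eq_sum, Fintype.sum_unique, Subsingleton.elim π 1, viaEmbedding_one,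
    inv_one, (isFilling_fill μ).coeff_symmetrizer_one]
  rfl

theorem sigma_finRotate_sub_moment_mem {n : ℕ}
    (H : ∀ (ι : Type) [Finite ι], Nat.card ι < n + 1 →
      ∀ π : Perm ι, sigma π ∈ momentAlgebra (Nat.card ι + 1)) :
    sigma (finRotate (n + 1)) - moment (n + 2) ∈ momentAlgebra (n + 1) := by
  classical
  rw [moment_add_two, sub_add_cancel_left]
  refine neg_mem (sum_mem fun r hr => ?_)
  split_ifs
  · exact zero_mem _
  · have hlt := card_quotient_lt (Finset.mem_filter.mp hr).2
    rw [Nat.card_fin] at hlt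
    exact momentAlgebra_mono hlt (H _ hlt _)

theorem sigma_mem_momentAlgebra (ι : Type) [Finite ι] (π : Perm ι) :
    sigma π ∈ momentAlgebra (Nat.card ι + 1) := by
  classical
  induction hm : Nat.card ι using Nat.strong_induction_on generalizing ι with
  | h m ih =>
    subst hm
    have H : ∀ (κ : Type) [Finite κ], Nat.card κ < Nat.card ι →
        ∀ σ : Perm κ, sigma σ ∈ momentAlgebra (Nat.card κ + 1) :=
      fun κ _ hκ σ => ih _ hκ κ σ rfl
    rcases isEmpty_or_nonempty ι with _ | ⟨⟨x⟩⟩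
    · rw [sigma_of_isEmpty]
      exact one_mem _
    obtain ⟨n, hn⟩ : ∃ n, Nat.card ι = n + 1 :=
      Nat.exists_eq_succ_of_ne_zero (Nat.card_pos_iff.mpr ⟨⟨x⟩, inferInstance⟩).ne'
    by_cases hx : ∀ y, π.SameCycle x y
    · obtain ⟨e, rfl⟩ := exists_permCongr_finRotate hn π x hx
      rw [hn] at H ⊢
      rw [sigma_permCongr, ← sub_add_cancel (sigma (finRotate (n + 1))) (moment (n + 2))]
      exact add_mem (momentAlgebra_mono (Nat.le_succ _) (sigma_finRotate_sub_moment_mem H))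
        (moment_mem_momentAlgebra (Nat.le_add_left _ _))
    · push Not at hx
      obtain ⟨y, hy⟩ := hx
      have := Fintype.ofFinite ι
      have hcard : Nat.card ({z // π.SameCycle x z} ⊕ {z // ¬ π.SameCycle x z}) = Nat.card ι :=
        Nat.card_congr (Equiv.sumCompl _)
      have hl : Nat.card {z // π.SameCycle x z} < Nat.card ι := by
        rw [Nat.card_eq_fintype_card, Nat.card_eq_fintype_card]
        exact Fintype.card_subtype_lt hy
      have hr : Nat.card {z // ¬ π.SameCycle x z} < Nat.card ι := by
        rw [Nat.card_eq_fintype_card, Nat.card_eq_fintype_card]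
        exact Fintype.card_subtype_lt (x := x) fun h => h (Perm.SameCycle.refl π x)
      have h₁ : ∀ z, π.SameCycle x (π z) ↔ π.SameCycle x z :=
        fun z => Perm.sameCycle_apply_right
      rw [← permCongr_sumCompl π (π.SameCycle x) h₁ fun z => (h₁ z).not, sigma_permCongr,
        sigma_sumCongr]
      refine sub_mem (mul_mem (momentAlgebra_mono (by omega) (H _ hl _))
        (momentAlgebra_mono (by omega) (H _ hr _))) (sum_mem fun r hr => ?_)
      split_ifs
      · have hlt := card_quotient_lt (Finset.mem_filter.mp hr).2
        rw [hcard] at hlt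
        exact momentAlgebra_mono (by omega) (H _ hlt _)
      · exact zero_mem _

theorem exists_polynomial_dilate {m : ℕ} {F : YoungDiagram → ℚ} (hF : F ∈ momentAlgebra m) :
    ∃ P : Polynomial (momentAlgebra m), ∀ μ : YoungDiagram, ∀ s : ℕ, 0 < s →
      F (dilate μ s) = Polynomial.eval (s : ℚ)
        (P.map ((Pi.evalRingHom (fun _ => ℚ) μ).comp (momentAlgebra m).val.toRingHom)) := by
  induction hF using Algebra.adjoin_induction with
  | mem F hF =>
    obtain ⟨j, h2, hj, rfl⟩ := hF
    refine ⟨Polynomial.monomial j ⟨moment j, momentAlgebra_mono hj (moment_mem_momentAlgebra h2)⟩,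
      fun μ s hs => ?_⟩
    rw [Polynomial.map_monomial, Polynomial.eval_monomial, moment_dilate μ hs, mul_comm]
    rfl
  | algebraMap r =>
    refine ⟨Polynomial.C (algebraMap ℤ _ r), fun μ s _ => ?_⟩
    rw [Polynomial.map_C, Polynomial.eval_C]
    rfl
  | add F G _ _ hF hG =>
    obtain ⟨P, hP⟩ := hF
    obtain ⟨Q, hQ⟩ := hG
    refine ⟨P + Q, fun μ s hs => ?_⟩
    rw [Polynomial.map_add, Polynomial.eval_add, ← hP μ s hs, ← hQ μ s hs, Pi.add_apply]
  | mul F G _ _ hF hG =>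
    obtain ⟨P, hP⟩ := hF
    obtain ⟨Q, hQ⟩ := hG
    refine ⟨P * Q, fun μ s hs => ?_⟩
    rw [Polynomial.map_mul, Polynomial.eval_mul, ← hP μ s hs, ← hQ μ s hs, Pi.mul_apply]

theorem freeCumulant_eq {μ : YoungDiagram} {k : ℕ} {p : Polynomial ℚ}
    (hp : ∀ s : ℕ, 0 < s → SigmaCycle (dilate μ s) (k - 1) = Polynomial.eval (s : ℚ) p) :
    freeCumulant μ k = p.coeff k := by
  have h : ∃ p : Polynomial ℚ, ∀ s : ℕ, 0 < s →
      SigmaCycle (dilate μ s) (k - 1) = Polynomial.eval (s : ℚ) p := ⟨p, hp⟩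
  rw [freeCumulant, dif_pos h]
  congr 1
  refine Polynomial.eq_of_infinite_eval_eq _ _ (Set.infinite_of_injective_forall_mem
    (f := fun n : ℕ => ((n + 1 : ℕ) : ℚ)) (fun a b hab => ?_) fun n => ?_)
  · simpa using hab
  · exact (h.choose_spec _ n.succ_pos).symm.trans (hp _ n.succ_pos)

theorem exists_freeCumulant_eq_moment_add (n : ℕ) :
    ∃ G ∈ momentAlgebra (n + 1), (fun μ => freeCumulant μ (n + 2)) = moment (n + 2) + G := by
  obtain ⟨P, hP⟩ := exists_polynomial_dilate
    (sigma_finRotate_sub_moment_mem (n := n) fun ι _ _ π => sigma_mem_momentAlgebra ι π)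
  refine ⟨(P.coeff (n + 2)).1, (P.coeff (n + 2)).2, funext fun μ => ?_⟩
  rw [freeCumulant_eq (p := Polynomial.monomial (n + 2) (moment (n + 2) μ) +
    P.map ((Pi.evalRingHom (fun _ => ℚ) μ).comp (momentAlgebra (n + 1)).val.toRingHom))]
  · rw [Polynomial.coeff_add, Polynomial.coeff_monomial, if_pos rfl, Polynomial.coeff_map]
    rfl
  · intro s hs
    rw [Polynomial.eval_add, ← hP μ s hs, Polynomial.eval_monomial, mul_comm,
      ← moment_dilate μ hs, SigmaCycle, normChar_eq_sigma, Pi.sub_apply]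
    simp

theorem momentAlgebra_le (m : ℕ) :
    momentAlgebra m ≤ Algebra.adjoin ℤ
      (Set.range fun (i : ℕ) (μ : YoungDiagram) => freeCumulant μ (i + 2)) := by
  induction m using Nat.strong_induction_on with
  | h m ih =>
    refine Algebra.adjoin_le ?_
    rintro _ ⟨j, h2, hj, rfl⟩
    obtain ⟨n, rfl⟩ := Nat.exists_eq_add_of_le' h2
    obtain ⟨G, hG, hR⟩ := exists_freeCumulant_eq_moment_add n
    rw [← add_sub_cancel_right (moment (n + 2)) G, ← hR]
    exact sub_mem (Algebra.subset_adjoin ⟨n, rfl⟩) (ih (n + 1) (by omega) hG)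

end Kerov

/-- **Kerov.** For every permutation `π ∈ S_k` there exists a polynomial `K_π` with
integer coefficients in the countably many variables `R_2, R_3, …` (the variable
`X i` standing for `R_{i+2}`), not depending on `μ`, such that for every Young
diagram `μ` one has `Σ_π^μ = K_π(R_2^μ, R_3^μ, …)`. -/
theorem kerov_polynomial_exists {k : ℕ} (π : Equiv.Perm (Fin k)) :
    ∃ K : MvPolynomial ℕ ℤ, ∀ μ : YoungDiagram,
      normChar μ π = MvPolynomial.aeval (fun i => freeCumulant μ (i + 2)) K := by
  have h := momentAlgebra_le _ (sigma_mem_momentAlgebra (Fin k) π)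
  rw [Algebra.adjoin_range_eq_range_aeval] at h
  obtain ⟨K, hK⟩ := h
  refine ⟨K, fun μ => ?_⟩
  rw [normChar_eq_sigma, ← hK]
  exact MvPolynomial.comp_aeval_apply _ (Pi.evalAlgHom ℤ (fun _ => ℚ) μ) K

end AsympRep
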